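/- arXiv:1703.05590 — 4 statements merged into one kernel-verified Lean document; each statement's English description precedes it below -/
import Mathlib

section
/- Fix a positive integer d, nonnegative integers p, q, r with p = 0 or q = 0, and set b = p + q + r. Fix an ordered partition ν of d. For a permutation σ ∈ S_d, let K(σ) be the number of tuples (τ₁,…,τ_b, σ₂) where each τ_i ∈ S_d is a transposition, the tuple (τ₁,…,τ_b) satisfies the (p,q)-monotonicity condition, the cycle type of σ₂ is ν, and σ₂·τ_b⋯τ₁·σ = id. Then K(σ) = K(σ') whenever σ and σ' are conjugate in S_d (i.e. have the same cycle type). -/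
/-- The larger moved point of a transposition (as a natural number):
the supremum of the values in its support. -/
def permTop {d : ℕ} (τ : Equiv.Perm (Fin d)) : ℕ := τ.support.sup Fin.val

/-- The full cycle type of a permutation: the multiset of orbit sizes on `{1,…,d}`,
with fixed points counted as orbits of size 1. -/
def fullCycleType {d : ℕ} (σ : Equiv.Perm (Fin d)) : Multiset ℕ :=
  σ.cycleType + Multiset.replicate (d - σ.support.card) 1

/-- The `(p,q)`-monotonicity condition on a tuple `(τ₁,…,τ_b)` of transpositions
(indexed here by `Fin b`, with index `i` corresponding to `τ_{i+1}`):
`top τ_k ≤ top τ_{k+1}` for `1 ≤ k ≤ p-1` and `top τ_k < top τ_{k+1}` for `p ≤ k ≤ p+q-1`. -/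
def MonCond {d b : ℕ} (p q : ℕ) (τ : Fin b → Equiv.Perm (Fin d)) : Prop :=
  ∀ i j : Fin b, (j : ℕ) = (i : ℕ) + 1 →
    ((i : ℕ) + 1 < p → permTop (τ i) ≤ permTop (τ j)) ∧
    (p ≤ (i : ℕ) + 1 → (i : ℕ) + 1 < p + q → permTop (τ i) < permTop (τ j))

open Equiv Finset in
theorem ptop_swap {d : ℕ} (a b : Fin d) (h : a ≠ b) : permTop (swap a b) = max (a : ℕ) b := by
  unfold permTop
  rw [Equiv.Perm.support_swap h]
  simp

theorem ptop_lt {d : ℕ} (x : Equiv.Perm (Fin d)) (h : x.IsSwap) : permTop x < d := by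
  obtain ⟨a, b, hab, rfl⟩ := h
  rw [ptop_swap a b hab]
  omega

abbrev GA (d : ℕ) := MonoidAlgebra ℤ (Equiv.Perm (Fin d))

noncomputable abbrev gof {d : ℕ} (x : Equiv.Perm (Fin d)) : GA d := MonoidAlgebra.of ℤ _ x

open Classical in
noncomputable def JM (d : ℕ) (j : ℕ) : GA d :=
  ∑ x : Equiv.Perm (Fin d), if x.IsSwap ∧ permTop x = j then gof x else 0

theorem isSwap_conj' {d : ℕ} (a b : Fin d) (y : Equiv.Perm (Fin d)) :
    (Equiv.swap a b * y * Equiv.swap a b).IsSwap ↔ y.IsSwap := by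
  have key : ∀ z : Equiv.Perm (Fin d), z.IsSwap →
      (Equiv.swap a b * z * Equiv.swap a b).IsSwap := by
    rintro z ⟨u, v, huv, rfl⟩
    refine ⟨Equiv.swap a b u, Equiv.swap a b v, by simpa using huv, ?_⟩
    have := Equiv.swap_apply_apply (Equiv.swap a b) u v
    rw [this, Equiv.swap_inv]
  constructor
  · intro h
    have := key _ h
    simpa [mul_assoc] using this
  · exact key y

theorem conj_swap' {d : ℕ} (a b u v : Fin d) :
    Equiv.swap a b * Equiv.swap u v * Equiv.swap a b =
      Equiv.swap (Equiv.swap a b u) (Equiv.swap a b v) := by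
  have := Equiv.swap_apply_apply (Equiv.swap a b) u v
  rw [this, Equiv.swap_inv]

theorem top_conj {d : ℕ} (a b : Fin d) (j : ℕ) (y : Equiv.Perm (Fin d)) (hy : y.IsSwap)
    (h : ((a : ℕ) < j ∧ (b : ℕ) < j) ∨ (j < (a : ℕ) ∧ j < (b : ℕ))) :
    permTop (Equiv.swap a b * y * Equiv.swap a b) = j ↔ permTop y = j := by
  obtain ⟨u, v, huv, rfl⟩ := hy
  rw [conj_swap', ptop_swap _ _ huv, ptop_swap _ _ (by simpa using huv)]
  simp only [Equiv.swap_apply_def]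
  split_ifs <;> simp_all [Fin.ext_iff] <;> omega

theorem top_conj2 {d : ℕ} (a b : Fin d) (hab : (b : ℕ) = a + 1) (y : Equiv.Perm (Fin d))
    (hy : y.IsSwap) :
    permTop (Equiv.swap a b * y * Equiv.swap a b) = a ↔
      permTop y = b ∧ y ≠ Equiv.swap a b := by
  obtain ⟨u, v, huv, rfl⟩ := hy
  have hne : a ≠ b := by intro h; subst h; omega
  have e : Equiv.swap u v = Equiv.swap a b ↔ (u = a ∧ v = b) ∨ (u = b ∧ v = a) := by
    constructor
    · intro h
      have h1 := congrArg (fun f => f a) h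
      have h2 := congrArg (fun f => f b) h
      simp only [Equiv.swap_apply_def] at h1 h2
      simp only [Fin.ext_iff] at *
      split_ifs at h1 h2 <;> omega
    · rintro (⟨rfl, rfl⟩ | ⟨rfl, rfl⟩)
      · rfl
      · exact Equiv.swap_comm _ _
  rw [conj_swap', ptop_swap _ _ huv, ptop_swap _ _ (by simpa using huv), ne_eq, e]
  clear e
  simp only [Equiv.swap_apply_def]
  simp only [Fin.ext_iff] at *
  split_ifs <;> omega

open Classical in
theorem JM_conj {d : ℕ} (a b : Fin d) (j : ℕ) :
    gof (Equiv.swap a b) * JM d j * gof (Equiv.swap a b) =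
      ∑ y : Equiv.Perm (Fin d), if y.IsSwap ∧
        permTop (Equiv.swap a b * y * Equiv.swap a b) = j then gof y else 0 := by
  unfold JM
  rw [Finset.mul_sum, Finset.sum_mul]
  refine Finset.sum_nbij' (fun x => Equiv.swap a b * x * Equiv.swap a b)
    (fun x => Equiv.swap a b * x * Equiv.swap a b) (by simp) (by simp)
    (by simp [mul_assoc]) (by simp [mul_assoc]) ?_
  intro x _
  have e : Equiv.swap a b * (Equiv.swap a b * x * Equiv.swap a b) * Equiv.swap a b = x := by
    simp [mul_assoc]
  rw [e, isSwap_conj']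
  split_ifs
  · simp only [gof, map_mul]
  · simp

theorem gof_sq {d : ℕ} (a b : Fin d) : gof (Equiv.swap a b) * gof (Equiv.swap a b) = 1 := by
  rw [← map_mul, Equiv.swap_mul_self, map_one]

theorem JM_commute {d : ℕ} (a b : Fin d) (j : ℕ)
    (h : ((a : ℕ) < j ∧ (b : ℕ) < j) ∨ (j < (a : ℕ) ∧ j < (b : ℕ))) :
    Commute (gof (Equiv.swap a b)) (JM d j) := by
  classical
  have h1 := JM_conj a b j
  have h2 : gof (Equiv.swap a b) * JM d j * gof (Equiv.swap a b) = JM d j := by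
    rw [h1, JM]
    refine Finset.sum_congr rfl fun y _ => ?_
    refine if_congr ?_ rfl rfl
    constructor
    · rintro ⟨hy, ht⟩
      exact ⟨hy, (top_conj a b j y hy h).1 ht⟩
    · rintro ⟨hy, ht⟩
      exact ⟨hy, (top_conj a b j y hy h).2 ht⟩
  unfold Commute SemiconjBy
  conv_rhs => rw [← h2]
  rw [mul_assoc _ (gof (Equiv.swap a b)) (gof (Equiv.swap a b)), gof_sq, mul_one]

theorem JM_adj {d : ℕ} (a b : Fin d) (hab : (b : ℕ) = a + 1) :
    gof (Equiv.swap a b) * JM d a * gof (Equiv.swap a b) = JM d b - gof (Equiv.swap a b) := by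
  classical
  have hne : a ≠ b := by intro h; subst h; omega
  rw [JM_conj, eq_sub_iff_add_eq, JM]
  have : gof (Equiv.swap a b) = ∑ y : Equiv.Perm (Fin d),
      if y = Equiv.swap a b then gof y else 0 := by simp
  conv_lhs => rw [this]
  rw [← Finset.sum_add_distrib]
  refine Finset.sum_congr rfl fun y _ => ?_
  by_cases hy : y.IsSwap
  · simp only [top_conj2 a b hab y hy]
    by_cases e : y = Equiv.swap a b
    · subst e
      have : permTop (Equiv.swap a b) = b := by rw [ptop_swap a b hne]; omega
      simp [this, hy]
    · simp [e]
  · have : y ≠ Equiv.swap a b := by rintro rfl; exact hy ⟨a, b, hne, rfl⟩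
    simp [hy, this]

theorem JM_comm {d : ℕ} (i j : ℕ) (hij : i < j) : Commute (JM d i) (JM d j) := by
  classical
  conv in JM d i => rw [JM]
  refine Commute.sum_left _ _ _ fun x _ => ?_
  split_ifs with h
  · obtain ⟨⟨a, b, hab, rfl⟩, h2⟩ := h
    rw [ptop_swap a b hab] at h2
    exact JM_commute a b j (by omega)
  · exact Commute.zero_left _

noncomputable def hS (d : ℕ) : ℕ → ℕ → GA d
  | _, 0 => 1
  | m, b + 1 => ∑ j ∈ Finset.range m, JM d j * hS d (j + 1) b

noncomputable def eS (d : ℕ) : ℕ → ℕ → GA d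
  | _, 0 => 1
  | m, b + 1 => ∑ j ∈ Finset.range m, JM d j * eS d j b

theorem hS_succ (d m b : ℕ) : hS d (m + 1) (b + 1) = hS d m (b + 1) + JM d m * hS d (m + 1) b := by
  rw [hS, hS, Finset.sum_range_succ]

theorem eS_succ (d m b : ℕ) : eS d (m + 1) (b + 1) = eS d m (b + 1) + JM d m * eS d m b := by
  rw [eS, eS, Finset.sum_range_succ]

section
variable {d : ℕ} (a b : Fin d) (hab : (b : ℕ) = a + 1)
include hab

theorem comm_add : Commute (gof (Equiv.swap a b)) (JM d a + JM d b) := by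
  have h := JM_adj a b hab
  have s2 := gof_sq a b
  set s := gof (Equiv.swap a b)
  have hb : JM d b = s * JM d a * s + s := by rw [h]; abel
  unfold Commute SemiconjBy
  rw [hb]
  have e1 : s * (s * JM d a * s) = JM d a * s := by rw [← mul_assoc, ← mul_assoc, s2, one_mul]
  have e2 : (s * JM d a * s) * s = s * JM d a := by rw [mul_assoc, s2, mul_one]
  rw [mul_add, mul_add, e1, add_mul, add_mul, e2]
  abel

theorem comm_mul : Commute (gof (Equiv.swap a b)) (JM d a * JM d b) := by
  have h := JM_adj a b hab
  have s2 := gof_sq a b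
  have hc : Commute (JM d a) (JM d b) := JM_comm _ _ (by omega)
  set s := gof (Equiv.swap a b)
  have hb : JM d b = s * JM d a * s + s := by rw [h]; abel
  have e1 : s * JM d b = JM d a * s + 1 := by
    rw [hb, mul_add, s2, ← mul_assoc, ← mul_assoc, s2, one_mul]
  have e2 : JM d b * s = s * JM d a + 1 := by
    rw [hb, add_mul, s2, mul_assoc, s2, mul_one]
  unfold Commute SemiconjBy
  calc s * (JM d a * JM d b) = (s * JM d b) * JM d a := by rw [hc.eq, mul_assoc]
    _ = JM d a * (s * JM d a + 1) := by rw [e1]; noncomm_ring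
    _ = JM d a * JM d b * s := by rw [← e2, mul_assoc]

theorem hS_low (n : ℕ) : ∀ m, m ≤ (a : ℕ) → Commute (gof (Equiv.swap a b)) (hS d m n) := by
  induction n with
  | zero => intro m _; rw [hS]; exact Commute.one_right _
  | succ n ih =>
    intro m hm
    rw [hS]
    refine Commute.sum_right _ _ _ fun j hj => ?_
    have := Finset.mem_range.1 hj
    exact (JM_commute a b j (by omega)).mul_right (ih _ (by omega))

theorem eS_low (n : ℕ) : ∀ m, m ≤ (a : ℕ) → Commute (gof (Equiv.swap a b)) (eS d m n) := by
  induction n with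
  | zero => intro m _; rw [eS]; exact Commute.one_right _
  | succ n ih =>
    intro m hm
    rw [eS]
    refine Commute.sum_right _ _ _ fun j hj => ?_
    have := Finset.mem_range.1 hj
    exact (JM_commute a b j (by omega)).mul_right (ih _ (by omega))

theorem hS_mid (n : ℕ) : Commute (gof (Equiv.swap a b)) (hS d (a + 2) n) ∧
    Commute (gof (Equiv.swap a b)) (hS d (a + 2) (n + 1)) := by
  have hadd := comm_add a b hab
  have hmul := comm_mul a b hab
  have hc : Commute (JM d a) (JM d b) := JM_comm _ _ (by omega)
  rw [hab] at hadd hmul hc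
  induction n with
  | zero =>
    refine ⟨by rw [hS]; exact Commute.one_right _, ?_⟩
    rw [hS_succ, hS_succ, hS, hS, mul_one, mul_one, add_assoc]
    exact (hS_low a b hab _ _ le_rfl).add_right hadd
  | succ n ih =>
    refine ⟨ih.2, ?_⟩
    have e : hS d (a + 2) (n + 2) = hS d a (n + 2) +
        (JM d a + JM d (a + 1)) * hS d (a + 2) (n + 1) -
        (JM d a * JM d (a + 1)) * hS d (a + 2) n := by
      have e1 : JM d a * hS d (a + 2) (n + 1) = JM d a * hS d (a + 1) (n + 1) +
          JM d a * JM d (a + 1) * hS d (a + 2) n := by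
        rw [hS_succ d (a + 1) n, mul_add, mul_assoc]
      rw [add_mul, e1, hS_succ d (a + 1) (n + 1), hS_succ d a (n + 1)]
      abel
    rw [e]
    exact ((hS_low a b hab _ _ le_rfl).add_right (hadd.mul_right ih.2)).sub_right
      (hmul.mul_right ih.1)

theorem eS_mid (n : ℕ) : Commute (gof (Equiv.swap a b)) (eS d (a + 2) n) := by
  have hadd := comm_add a b hab
  have hmul := comm_mul a b hab
  have hc : Commute (JM d a) (JM d b) := JM_comm _ _ (by omega)
  rw [hab] at hadd hmul hc
  match n with
  | 0 => rw [eS]; exact Commute.one_right _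
  | 1 =>
    rw [eS_succ, eS_succ, eS, eS, mul_one, mul_one, add_assoc]
    exact (eS_low a b hab _ _ le_rfl).add_right hadd
  | n + 2 =>
    have e : eS d (a + 2) (n + 2) = eS d a (n + 2) +
        (JM d a + JM d (a + 1)) * eS d a (n + 1) +
        (JM d a * JM d (a + 1)) * eS d a n := by
      rw [eS_succ d (a + 1) (n + 1), eS_succ d a (n + 1), eS_succ d a n, hc.eq]
      noncomm_ring
    rw [e]
    exact ((eS_low a b hab _ _ le_rfl).add_right (hadd.mul_right (eS_low a b hab _ _ le_rfl))).add_right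
      (hmul.mul_right (eS_low a b hab _ _ le_rfl))

theorem hS_high (n : ℕ) : ∀ m, (a : ℕ) + 2 ≤ m → Commute (gof (Equiv.swap a b)) (hS d m n) := by
  induction n with
  | zero => intro m _; rw [hS]; exact Commute.one_right _
  | succ n ih =>
    intro m hm
    induction m, hm using Nat.le_induction with
    | base => exact (hS_mid a b hab n).2
    | succ m hm ihm =>
      rw [hS_succ]
      exact ihm.add_right ((JM_commute a b m (by omega)).mul_right (ih _ (by omega)))

theorem eS_high (n : ℕ) : ∀ m, (a : ℕ) + 2 ≤ m → Commute (gof (Equiv.swap a b)) (eS d m n) := by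
  induction n with
  | zero => intro m _; rw [eS]; exact Commute.one_right _
  | succ n ih =>
    intro m hm
    induction m, hm using Nat.le_induction with
    | base => exact eS_mid a b hab (n + 1)
    | succ m hm ihm =>
      rw [eS_succ]
      exact ihm.add_right ((JM_commute a b m (by omega)).mul_right (ih _ (by omega)))
end

theorem central_of_adj {d : ℕ} (A : GA d)
    (h : ∀ a b : Fin d, (b : ℕ) = a + 1 → Commute (gof (Equiv.swap a b)) A)
    (g : Equiv.Perm (Fin d)) : Commute (gof g) A := by
  cases d with
  | zero =>
    have : g = 1 := Subsingleton.elim _ _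
    rw [this, gof, map_one]; exact Commute.one_left _
  | succ n =>
    have hg : g ∈ Submonoid.closure
        (Set.range fun i : Fin n => Equiv.swap i.castSucc i.succ) := by
      rw [Equiv.Perm.mclosure_swap_castSucc_succ]; trivial
    induction hg using Submonoid.closure_induction with
    | mem x hx =>
      obtain ⟨i, rfl⟩ := hx
      exact h _ _ (by simp)
    | one => rw [gof, map_one]; exact Commute.one_left _
    | mul x y _ _ hx hy => rw [gof, map_mul]; exact hx.mul_left hy

def Adm {d : ℕ} (p q b : ℕ) (τ : Fin b → Equiv.Perm (Fin d)) : Prop :=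
  (∀ i, (τ i).IsSwap) ∧ MonCond p q τ

open Classical in
noncomputable def SS (d p q m b : ℕ) : GA d :=
  ∑ τ : Fin b → Equiv.Perm (Fin d),
    if Adm p q b τ ∧ ∀ i : Fin b, (i : ℕ) + 1 = b → permTop (τ i) < m
    then gof (List.ofFn τ).reverse.prod else 0

theorem MonCond_snoc {d : ℕ} (p q b : ℕ) (τ : Fin b → Equiv.Perm (Fin d))
    (x : Equiv.Perm (Fin d)) :
    MonCond p q (Fin.snoc τ x : Fin (b + 1) → Equiv.Perm (Fin d)) ↔ MonCond p q τ ∧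
      ∀ i : Fin b, (i : ℕ) + 1 = b → (b < p → permTop (τ i) ≤ permTop x) ∧
        (p ≤ b → b < p + q → permTop (τ i) < permTop x) := by
  constructor
  · intro h
    constructor
    · intro i j hij
      have := h i.castSucc j.castSucc (by simpa using hij)
      simpa using this
    · intro i hi
      have := h i.castSucc (Fin.last b) (by simp [hi])
      simpa [hi] using this
  · rintro ⟨h1, h2⟩ i j hij
    induction i using Fin.lastCases with
    | last => simp at hij; omega
    | cast i =>
      induction j using Fin.lastCases with
      | last =>
        have hi : (i : ℕ) + 1 = b := by simp at hij; omega
        have := h2 i hi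
        simpa [hi] using this
      | cast j =>
        have := h1 i j (by simpa using hij)
        simpa using this

theorem SS_succ (d p q m b : ℕ) (φ : ℕ → ℕ)
    (hφ : ∀ u v : ℕ, u < d → (((b < p → u ≤ v) ∧ (p ≤ b → b < p + q → u < v)) ↔ u < φ v)) :
    SS d p q m (b + 1) = ∑ j ∈ Finset.range m, JM d j * SS d p q (φ j) b := by
  classical
  have step : SS d p q m (b + 1) = ∑ x : Equiv.Perm (Fin d),
      if x.IsSwap ∧ permTop x < m then gof x * SS d p q (φ (permTop x)) b else 0 := by
    rw [SS, ← (Fin.snocEquiv fun _ : Fin (b + 1) => Equiv.Perm (Fin d)).sum_comp,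
      Fintype.sum_prod_type]
    refine Finset.sum_congr rfl fun x _ => ?_
    have key : ∀ τ : Fin b → Equiv.Perm (Fin d),
        (Adm p q (b + 1) (Fin.snoc τ x : Fin (b + 1) → Equiv.Perm (Fin d)) ∧
          ∀ i : Fin (b + 1), (i : ℕ) + 1 = b + 1 →
            permTop ((Fin.snoc τ x : Fin (b + 1) → Equiv.Perm (Fin d)) i) < m) ↔
        (x.IsSwap ∧ permTop x < m) ∧ (Adm p q b τ ∧
          ∀ i : Fin b, (i : ℕ) + 1 = b → permTop (τ i) < φ (permTop x)) := by
      intro τ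
      unfold Adm
      rw [MonCond_snoc, Fin.forall_fin_succ', Fin.forall_fin_succ']
      simp only [Fin.snoc_castSucc, Fin.snoc_last, Fin.val_castSucc, Fin.val_last]
      constructor
      · rintro ⟨⟨⟨h1, h2⟩, h3, h4⟩, h5, h6⟩
        exact ⟨⟨h2, h6 trivial⟩, ⟨h1, h3⟩, fun i hi => (hφ _ _ (ptop_lt _ (h1 i))).1 (h4 i hi)⟩
      · rintro ⟨⟨h2, h6⟩, ⟨h1, h3⟩, h4⟩
        exact ⟨⟨⟨h1, h2⟩, h3, fun i hi => (hφ _ _ (ptop_lt _ (h1 i))).2 (h4 i hi)⟩,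
          fun i hi => by have := i.2; omega, fun _ => h6⟩
    have prd : ∀ τ : Fin b → Equiv.Perm (Fin d),
        (List.ofFn (Fin.snoc τ x : Fin (b + 1) → Equiv.Perm (Fin d))).reverse.prod =
          x * (List.ofFn τ).reverse.prod := by
      intro τ
      rw [List.ofFn_succ']
      simp
    have sn : ∀ τ : Fin b → Equiv.Perm (Fin d),
        (Fin.snocEquiv fun _ : Fin (b + 1) => Equiv.Perm (Fin d)) (x, τ) =
          (Fin.snoc τ x : Fin (b + 1) → Equiv.Perm (Fin d)) := fun _ => rfl
    simp only [sn]
    by_cases hx : x.IsSwap ∧ permTop x < m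
    · rw [if_pos hx, SS, Finset.mul_sum]
      refine Finset.sum_congr rfl fun τ _ => ?_
      rw [prd, mul_ite, mul_zero]
      refine if_congr ((key τ).trans ?_) (map_mul _ _ _) rfl
      simp only [hx, true_and, and_self]
    · rw [if_neg hx]
      refine Finset.sum_eq_zero fun τ _ => ?_
      rw [if_neg]
      rw [key τ]
      exact fun h => hx h.1
  rw [step]
  simp only [JM, Finset.sum_mul]
  rw [Finset.sum_comm]
  refine Finset.sum_congr rfl fun x _ => ?_
  by_cases hx : x.IsSwap
  · simp [hx, ite_mul]
  · simp [hx]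

theorem SS_zero (d p q m : ℕ) : SS d p q m 0 = 1 := by
  classical
  have : ∀ τ : Fin 0 → Equiv.Perm (Fin d), Adm p q 0 τ :=
    fun τ => ⟨fun i => i.elim0, fun i => i.elim0⟩
  rw [SS, Fintype.sum_unique, if_pos ⟨this _, fun i => i.elim0⟩]
  simp [MonoidAlgebra.one_def]

theorem SS_h (d p b : ℕ) (hb : b ≤ p) : ∀ m, SS d p 0 m b = hS d m b := by
  induction b with
  | zero => intro m; rw [SS_zero, hS]
  | succ b ih =>
    intro m
    rw [SS_succ d p 0 m b (fun v => v + 1) (by intro u v _; omega), hS]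
    simp only [ih (by omega)]

theorem SS_e (d q b : ℕ) (hb : b ≤ q) : ∀ m, SS d 0 q m b = eS d m b := by
  induction b with
  | zero => intro m; rw [SS_zero, eS]
  | succ b ih =>
    intro m
    rw [SS_succ d 0 q m b (fun v => v) (by intro u v _; omega), eS]
    simp only [ih (by omega)]

theorem SS_central (d p q r : ℕ) (hpq : p = 0 ∨ q = 0) (g : Equiv.Perm (Fin d)) :
    Commute (gof g) (SS d p q d (p + q + r)) := by
  induction r with
  | zero =>
    rcases hpq with rfl | rfl
    · rw [SS_e _ _ _ (by omega)]
      exact central_of_adj _ (fun a b hab => eS_high a b hab _ _ (by omega)) g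
    · rw [SS_h _ _ _ (by omega)]
      exact central_of_adj _ (fun a b hab => hS_high a b hab _ _ (by omega)) g
  | succ r ih =>
    rw [← add_assoc, SS_succ d p q d (p + q + r) (fun _ => d) (by intro u v _; omega),
      ← Finset.sum_mul]
    refine Commute.mul_right ?_ ih
    have : ∑ j ∈ Finset.range d, JM d j = hS d d 1 := by simp [hS]
    rw [this]
    exact central_of_adj _ (fun a b hab => hS_high a b hab _ _ (by omega)) g

open Classical in
theorem SS_coeff (d p q b : ℕ) (π : Equiv.Perm (Fin d)) :
    (SS d p q d b).coeff π = (Nat.card { τ : Fin b → Equiv.Perm (Fin d) //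
      Adm p q b τ ∧ (List.ofFn τ).reverse.prod = π } : ℤ) := by
  rw [SS, MonoidAlgebra.coeff_sum, Finsupp.finsetSum_apply, Nat.card_eq_fintype_card,
    Fintype.card_subtype, Finset.card_filter, Nat.cast_sum]
  refine Finset.sum_congr rfl fun τ _ => ?_
  by_cases h : Adm p q b τ
  · rw [if_pos ⟨h, fun i _ => ptop_lt _ (h.1 i)⟩]
    simp [h, MonoidAlgebra.of_apply, Finsupp.single_apply]
  · simp [h]

theorem card_conj (d p q r : ℕ) (hpq : p = 0 ∨ q = 0) (g π : Equiv.Perm (Fin d)) :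
    Nat.card { τ : Fin (p + q + r) → Equiv.Perm (Fin d) //
      Adm p q _ τ ∧ (List.ofFn τ).reverse.prod = g * π * g⁻¹ } =
    Nat.card { τ : Fin (p + q + r) → Equiv.Perm (Fin d) //
      Adm p q _ τ ∧ (List.ofFn τ).reverse.prod = π } := by
  have h := (SS_central d p q r hpq g).eq
  have h2 := congrArg (fun A : GA d => A.coeff (g * π)) h
  simp only [gof, MonoidAlgebra.of_apply, MonoidAlgebra.coeff_single_mul_apply,
    MonoidAlgebra.coeff_mul_single_apply, one_mul, mul_one, inv_mul_cancel_left] at h2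
  rw [SS_coeff, SS_coeff] at h2
  exact_mod_cast h2.symm

theorem full_conj {d : ℕ} (g x : Equiv.Perm (Fin d)) :
    fullCycleType (g * x * g⁻¹) = fullCycleType x := by
  unfold fullCycleType
  rw [Equiv.Perm.cycleType_conj, Equiv.Perm.card_support_conj]

theorem K_eq (d p q b : ℕ) (N : Multiset ℕ) (σ : Equiv.Perm (Fin d)) :
    Nat.card { t : (Fin b → Equiv.Perm (Fin d)) × Equiv.Perm (Fin d) //
        (∀ i, (t.1 i).IsSwap) ∧ MonCond p q t.1 ∧
        fullCycleType t.2 = N ∧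
        t.2 * (List.ofFn t.1).reverse.prod * σ = 1 } =
    ∑ s : { s : Equiv.Perm (Fin d) // fullCycleType s = N },
      Nat.card { τ : Fin b → Equiv.Perm (Fin d) //
        Adm p q b τ ∧ (List.ofFn τ).reverse.prod = s.1⁻¹ * σ⁻¹ } := by
  rw [← Nat.card_sigma]
  have e : ∀ s P : Equiv.Perm (Fin d), s * P * σ = 1 ↔ P = s⁻¹ * σ⁻¹ := by
    intro s P
    rw [mul_eq_one_iff_eq_inv, eq_inv_mul_iff_mul_eq]
  exact Nat.card_congr
    { toFun := fun t => ⟨⟨t.1.2, t.2.2.2.1⟩, ⟨t.1.1, ⟨t.2.1, t.2.2.1⟩, (e _ _).1 t.2.2.2.2⟩⟩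
      invFun := fun t => ⟨(t.2.1, t.1.1), t.2.2.1.1, t.2.2.1.2, t.1.2, (e _ _).2 t.2.2.2⟩
      left_inv := fun _ => rfl
      right_inv := fun _ => rfl }

def conjTypeEquiv {d : ℕ} (N : Multiset ℕ) (g : Equiv.Perm (Fin d)) :
    { s : Equiv.Perm (Fin d) // fullCycleType s = N } ≃
      { s : Equiv.Perm (Fin d) // fullCycleType s = N } where
  toFun := fun s => ⟨g * s.1 * g⁻¹, by rw [full_conj]; exact s.2⟩
  invFun := fun s => ⟨g⁻¹ * s.1 * g, by
    have := full_conj g⁻¹ s.1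
    rw [inv_inv] at this
    rw [this]; exact s.2⟩
  left_inv := fun s => by apply Subtype.ext; simp [mul_assoc]
  right_inv := fun s => by apply Subtype.ext; simp [mul_assoc]

/-- The count `K(σ)` of tuples `(τ₁,…,τ_b,σ₂)` with each `τᵢ` a transposition,
`(τ₁,…,τ_b)` satisfying the `(p,q)`-monotonicity condition, the cycle type of `σ₂`
equal to `ν`, and `σ₂·τ_b⋯τ₁·σ = id`, does not change when `σ` is replaced by a
conjugate permutation (here `p = 0` or `q = 0`, `b = p + q + r`, and `ν` is an
ordered partition of `d`). -/
theorem conjugation_invariance_of_interpolated_count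
    (d p q r : ℕ) (hd : 0 < d) (hpq : p = 0 ∨ q = 0)
    (n : ℕ) (ν : Fin n → ℕ) (hν : ∀ j, 0 < ν j) (hνsum : ∑ j, ν j = d)
    (σ σ' : Equiv.Perm (Fin d)) (hconj : IsConj σ σ') :
    Nat.card { t : (Fin (p + q + r) → Equiv.Perm (Fin d)) × Equiv.Perm (Fin d) //
        (∀ i, (t.1 i).IsSwap) ∧ MonCond p q t.1 ∧
        fullCycleType t.2 = (List.ofFn ν : Multiset ℕ) ∧
        t.2 * (List.ofFn t.1).reverse.prod * σ = 1 } =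
    Nat.card { t : (Fin (p + q + r) → Equiv.Perm (Fin d)) × Equiv.Perm (Fin d) //
        (∀ i, (t.1 i).IsSwap) ∧ MonCond p q t.1 ∧
        fullCycleType t.2 = (List.ofFn ν : Multiset ℕ) ∧
        t.2 * (List.ofFn t.1).reverse.prod * σ' = 1 } := by
  classical
  obtain ⟨g, hg⟩ := isConj_iff.1 hconj
  rw [K_eq, K_eq]
  refine Fintype.sum_equiv (conjTypeEquiv _ g) _ _ ?_
  intro s
  rw [← card_conj d p q r hpq g]
  have : g * (s.1⁻¹ * σ⁻¹) * g⁻¹ = (g * s.1 * g⁻¹)⁻¹ * σ'⁻¹ := by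
    rw [← hg]; group
  rw [this]
  rfl
end

section
/- Fix a positive integer d, nonnegative integers p, q, r with p = 0 or q = 0, and set b = p + q + r. Fix an ordered partition ν of d. For a permutation σ ∈ S_d, let K°(σ) be the number of tuples (τ₁,…,τ_b, σ₂) where each τ_i ∈ S_d is a transposition, the tuple (τ₁,…,τ_b) satisfies the (p,q)-monotonicity condition, the cycle type of σ₂ is ν, σ₂·τ_b⋯τ₁·σ = id, and the subgroup of S_d generated by σ, τ₁,…,τ_b, σ₂ acts transitively on {1,…,d}. Then K°(σ) = K°(σ') whenever σ and σ' are conjugate in S_d (i.e. have the same cycle type). -/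
open Equiv in
theorem ci_abstract {A : Type*} [Ring A] (φ : A →+* A) (J : ℕ → A) (F : ℕ → ℕ → A) (ε i : ℕ)
    (hε : ε = 0 ∨ ε = 1)
    (hJ : ∀ j, j ≠ i → j ≠ i + 1 → φ (J j) = J j)
    (hsum : φ (J i + J (i+1)) = J i + J (i+1))
    (hprod : φ (J i * J (i+1)) = J i * J (i+1))
    (hcomm : J i * J (i+1) = J (i+1) * J i)
    (F0 : ∀ k, F 0 k = 1) (Fz : ∀ n, F (n+1) 0 = 0)
    (Fs : ∀ n k, F (n+1) (k+1) = F (n+1) k + J k * F n (k + ε)) :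
    ∀ n k, k ≠ i + 1 → φ (F n k) = F n k := by
  intro n
  induction n using Nat.strong_induction_on with
  | _ n ihn =>
  intro k
  induction k using Nat.strong_induction_on with
  | _ k ihk =>
  intro hk
  rcases n with _ | n
  · rw [F0, map_one]
  rcases k with _ | k
  · rw [Fz, map_zero]
  by_cases hki : k = i + 1
  · subst hki
    have hi := ihk i (by omega) (by omega)
    rcases n with _ | n
    · have e : F (0+1) (i+1+1) = F (0+1) i + (J i + J (i+1)) := by
        rw [Fs, Fs, F0, F0]; simp [add_assoc]
      rw [e, map_add, hi, hsum]
    · rcases hε with rfl | rfl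
      · have e : F (n+1+1) (i+1+1) = F (n+1+1) i + (J i + J (i+1)) * F (n+1) i
            + (J i * J (i+1)) * F n i := by
          rw [Fs (n+1) (i+1), Fs (n+1) i]
          simp only [Nat.add_zero]
          rw [Fs n i, hcomm]
          simp only [Nat.add_zero]
          noncomm_ring
        rw [e, map_add, map_add, map_mul, map_mul, hi, hsum, hprod,
          ihn (n+1) (by omega) i (by omega), ihn n (by omega) i (by omega)]
      · have e : F (n+1+1) (i+1+1) = F (n+1+1) i + (J i + J (i+1)) * F (n+1) (i+1+1)
            - (J i * J (i+1)) * F n (i+1+1) := by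
          have h1 := Fs (n+1) (i+1)
          have h2 := Fs (n+1) i
          have h3 := Fs n (i+1)
          have h4 : F (n+1) (i+1) = F (n+1) (i+1+1) - J (i+1) * F n (i+1+1) := by
            rw [h3]; abel
          rw [h1, h2, h4]
          noncomm_ring
        rw [e, map_sub, map_add, map_mul, map_mul, hi, hsum, hprod,
          ihn (n+1) (by omega) _ (by omega), ihn n (by omega) _ (by omega)]
  · have hki' : k ≠ i := by omega
    rw [Fs, map_add, map_mul, hJ k hki' hki, ihk k (by omega) hki,
      ihn n (by omega) _ (by omega)]

/-- Pairs (subgroup, permutation) with product given by join and multiplication. -/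
@[ext] structure PM (d : ℕ) where
  H : Subgroup (Equiv.Perm (Fin d))
  g : Equiv.Perm (Fin d)

noncomputable instance (d : ℕ) : Monoid (PM d) where
  mul a b := ⟨a.H ⊔ b.H, a.g * b.g⟩
  one := ⟨⊥, 1⟩
  mul_assoc a b c := PM.ext (sup_assoc _ _ _) (mul_assoc _ _ _)
  one_mul a := PM.ext (bot_sup_eq _) (one_mul _)
  mul_one a := PM.ext (sup_bot_eq _) (mul_one _)

theorem PM.mul_def {d : ℕ} (a b : PM d) : a * b = ⟨a.H ⊔ b.H, a.g * b.g⟩ := rfl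
theorem PM.one_def {d : ℕ} : (1 : PM d) = ⟨⊥, 1⟩ := rfl

noncomputable def PM.conj {d : ℕ} (s : Equiv.Perm (Fin d)) : PM d →* PM d where
  toFun a := ⟨a.H.map (MulAut.conj s).toMonoidHom, s * a.g * s⁻¹⟩
  map_one' := by simp [PM.one_def]
  map_mul' a b := by simp [PM.mul_def, Subgroup.map_sup]

theorem PM.conj_apply {d : ℕ} (s : Equiv.Perm (Fin d)) (a : PM d) :
    PM.conj s a = ⟨a.H.map (MulAut.conj s).toMonoidHom, s * a.g * s⁻¹⟩ := rfl

noncomputable def PM.y {d : ℕ} (t : Equiv.Perm (Fin d)) : PM d := ⟨Subgroup.closure {t}, t⟩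

theorem PM.conj_y {d : ℕ} (s t : Equiv.Perm (Fin d)) : PM.conj s (PM.y t) = PM.y (s * t * s⁻¹) := by
  simp [PM.conj_apply, PM.y, MonoidHom.map_closure]

theorem PM.conj_mul {d : ℕ} (s t : Equiv.Perm (Fin d)) :
    PM.conj (s * t) = (PM.conj s).comp (PM.conj t) := by
  ext a : 1
  simp [PM.conj_apply, Subgroup.map_map, mul_assoc]
  rfl

theorem PM.conj_one {d : ℕ} : PM.conj (1 : Equiv.Perm (Fin d)) = MonoidHom.id _ := by
  ext a : 1
  refine PM.ext ?_ (by simp [PM.conj_apply])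
  ext x
  simp [PM.conj_apply]

theorem PM.y_mul {d : ℕ} (t : Equiv.Perm (Fin d)) (a : PM d) :
    PM.y t * a = PM.conj t a * PM.y t := by
  have ht : t ∈ Subgroup.closure {t} := Subgroup.subset_closure rfl
  refine PM.ext ?_ (by simp [PM.mul_def, PM.conj_apply, PM.y])
  simp only [PM.mul_def, PM.conj_apply, PM.y]
  apply le_antisymm
  · refine sup_le le_sup_right ?_
    intro h hh
    have h1 : t * h * t⁻¹ ∈ Subgroup.map (MulAut.conj t).toMonoidHom a.H ⊔ Subgroup.closure {t} :=
      Subgroup.mem_sup_left ⟨h, hh, rfl⟩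
    have h2 : t ∈ Subgroup.map (MulAut.conj t).toMonoidHom a.H ⊔ Subgroup.closure {t} :=
      Subgroup.mem_sup_right ht
    have := mul_mem (mul_mem (inv_mem h2) h1) h2
    simpa [mul_assoc] using this
  · refine sup_le ?_ le_sup_left
    rintro _ ⟨h, hh, rfl⟩
    have h1 : h ∈ Subgroup.closure {t} ⊔ a.H := Subgroup.mem_sup_right hh
    have h2 : t ∈ Subgroup.closure {t} ⊔ a.H := Subgroup.mem_sup_left ht
    exact mul_mem (mul_mem h2 h1) (inv_mem h2)

abbrev PA (d : ℕ) := MonoidAlgebra ℤ (PM d)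

noncomputable def PA.X {d : ℕ} (a : PM d) : PA d := MonoidAlgebra.single a 1

theorem PA.X_mul {d : ℕ} (a b : PM d) : PA.X (a * b) = PA.X a * PA.X b := by
  simp [PA.X, MonoidAlgebra.single_mul_single]

theorem PA.X_one {d : ℕ} : PA.X (1 : PM d) = 1 := rfl

noncomputable def PA.phi {d : ℕ} (s : Equiv.Perm (Fin d)) : PA d →+* PA d :=
  MonoidAlgebra.mapDomainRingHom ℤ (PM.conj s)

theorem PA.phi_X {d : ℕ} (s : Equiv.Perm (Fin d)) (a : PM d) :
    PA.phi s (PA.X a) = PA.X (PM.conj s a) := by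
  simp [PA.phi, PA.X]

theorem PA.phi_mul {d : ℕ} (s t : Equiv.Perm (Fin d)) (z : PA d) :
    PA.phi (s * t) z = PA.phi s (PA.phi t z) := by
  simp only [PA.phi, PM.conj_mul, MonoidAlgebra.mapDomainRingHom_comp, RingHom.comp_apply]

theorem PA.phi_one {d : ℕ} (z : PA d) : PA.phi 1 z = z := by
  simp [PA.phi, PM.conj_one]

noncomputable def PA.x {d : ℕ} (t : Equiv.Perm (Fin d)) : PA d := PA.X (PM.y t)

theorem PA.phi_x {d : ℕ} (s t : Equiv.Perm (Fin d)) :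
    PA.phi s (PA.x t) = PA.x (s * t * s⁻¹) := by
  simp [PA.x, PA.phi_X, PM.conj_y]

theorem PA.phi_swap {d : ℕ} (s : Equiv.Perm (Fin d)) (a b : Fin d) :
    PA.phi s (PA.x (Equiv.swap a b)) = PA.x (Equiv.swap (s a) (s b)) := by
  rw [PA.phi_x, Equiv.swap_apply_apply]

theorem PA.x_mul {d : ℕ} (t : Equiv.Perm (Fin d)) (z : PA d) :
    PA.x t * z = PA.phi t z * PA.x t := by
  induction z using MonoidAlgebra.induction_linear with
  | zero => simp
  | add f g hf hg => rw [mul_add, hf, hg, map_add, add_mul]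
  | single a r =>
    have : (MonoidAlgebra.single a r : PA d) = r • PA.X a := by simp [PA.X]
    rw [this, map_zsmul, PA.phi_X, mul_smul_comm, smul_mul_assoc, PA.x, ← PA.X_mul, ← PA.X_mul,
      PM.y_mul]

open Classical in
noncomputable def PA.J (d : ℕ) (j : ℕ) : PA d :=
  ∑ t : Equiv.Perm (Fin d), if t.IsSwap ∧ permTop t = j then PA.x t else 0

theorem permTop_swap {d : ℕ} (a b : Fin d) (h : a < b) : permTop (Equiv.swap a b) = b := by
  rw [permTop, Equiv.Perm.support_swap h.ne]
  simp
  exact h.le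

theorem PA.J_eq {d : ℕ} (c : Fin d) : PA.J d c = ∑ a ∈ Finset.Iio c, PA.x (Equiv.swap a c) := by
  classical
  rw [PA.J, ← Finset.sum_filter]
  symm
  refine Finset.sum_bij (fun a _ => Equiv.swap a c) ?_ ?_ ?_ ?_
  · intro a ha
    have ha : a < c := by simpa using ha
    simp only [Finset.mem_filter, Finset.mem_univ, true_and]
    exact ⟨⟨a, c, ha.ne, rfl⟩, permTop_swap a c ha⟩
  · intro a ha b hb hab
    have := congrArg (fun f => f c) hab
    simpa using this
  · intro t ht
    simp only [Finset.mem_filter, Finset.mem_univ, true_and] at ht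
    obtain ⟨⟨a, b, hab, rfl⟩, ht⟩ := ht
    rcases lt_or_gt_of_ne hab with h | h
    · rw [permTop_swap a b h] at ht
      have := Fin.ext ht
      subst this
      exact ⟨a, by simpa using h, rfl⟩
    · rw [Equiv.swap_comm, permTop_swap b a h] at ht
      have := Fin.ext ht
      subst this
      exact ⟨b, by simpa using h, Equiv.swap_comm _ _⟩
  · intros; rfl

theorem PA.J_big {d : ℕ} (j : ℕ) (hj : d ≤ j) : PA.J d j = 0 := by
  classical
  rw [PA.J]
  refine Finset.sum_eq_zero fun t _ => if_neg ?_
  rintro ⟨⟨a, b, hab, rfl⟩, ht⟩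
  rcases lt_or_gt_of_ne hab with h | h
  · rw [permTop_swap a b h] at ht; omega
  · rw [Equiv.swap_comm, permTop_swap b a h] at ht; omega

theorem PA.phi_J_fix {d : ℕ} (s : Equiv.Perm (Fin d)) (c : Fin d) (hc : s c = c)
    (hs : ∀ a, a < c ↔ s a < c) : PA.phi s (PA.J d c) = PA.J d c := by
  rw [PA.J_eq, map_sum]
  refine Finset.sum_equiv s (by intro a; simpa using hs a) ?_
  intro a _
  rw [PA.phi_swap, hc]

theorem PA.J_succ {d : ℕ} (i c : Fin d) (h : (c : ℕ) = i + 1) :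
    PA.J d c = (∑ a ∈ Finset.Iio i, PA.x (Equiv.swap a c)) + PA.x (Equiv.swap i c) := by
  rw [PA.J_eq]
  have : Finset.Iio c = insert i (Finset.Iio i) := by
    ext a; simp only [Finset.mem_Iio, Finset.mem_insert, Fin.lt_def, Fin.ext_iff]; omega
  rw [this, Finset.sum_insert (by simp), add_comm]

theorem PA.phi_J_i {d : ℕ} (i c : Fin d) (h : (c : ℕ) = i + 1) :
    PA.phi (Equiv.swap i c) (PA.J d i) = PA.J d c - PA.x (Equiv.swap i c) := by
  rw [PA.J_succ i c h, PA.J_eq, map_sum, add_sub_cancel_right]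
  refine Finset.sum_congr rfl fun a ha => ?_
  have ha : a < i := by simpa using ha
  have hac : a < c := by rw [Fin.lt_def] at *; omega
  rw [PA.phi_swap, Equiv.swap_apply_left, Equiv.swap_apply_of_ne_of_ne ha.ne hac.ne]

theorem PA.phi_J_c {d : ℕ} (i c : Fin d) (h : (c : ℕ) = i + 1) :
    PA.phi (Equiv.swap i c) (PA.J d c) = PA.J d i + PA.x (Equiv.swap i c) := by
  have h1 : PA.J d c = PA.phi (Equiv.swap i c) (PA.J d i) + PA.x (Equiv.swap i c) := by
    rw [PA.phi_J_i i c h, sub_add_cancel]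
  rw [h1, map_add, ← PA.phi_mul, Equiv.swap_mul_self, PA.phi_one, PA.phi_swap]
  simp [Equiv.swap_comm]

theorem PA.J_comm {d : ℕ} (i c : Fin d) (h : i < c) :
    PA.J d i * PA.J d c = PA.J d c * PA.J d i := by
  rw [PA.J_eq i, Finset.sum_mul, Finset.mul_sum]
  refine Finset.sum_congr rfl fun a ha => ?_
  have ha : a < i := by simpa using ha
  rw [PA.x_mul, PA.phi_J_fix]
  · exact Equiv.swap_apply_of_ne_of_ne (ha.trans h).ne' h.ne'
  · intro b
    by_cases h1 : b = a
    · subst h1; simp [h, ha.trans h]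
    by_cases h2 : b = i
    · subst h2; simp [h, ha.trans h]
    rw [Equiv.swap_apply_of_ne_of_ne h1 h2]

theorem PA.J_prod {d : ℕ} (i c : Fin d) (h : (c : ℕ) = i + 1) :
    PA.phi (Equiv.swap i c) (PA.J d i * PA.J d c) = PA.J d i * PA.J d c := by
  have hic : i < c := by rw [Fin.lt_def]; omega
  have hx := PA.x_mul (Equiv.swap i c) (PA.J d c)
  rw [PA.phi_J_c i c h] at hx
  rw [PA.J_comm i c hic, map_mul, PA.phi_J_i i c h, PA.phi_J_c i c h, ← PA.J_comm i c hic,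
    mul_sub, add_mul, hx]
  abel

theorem PA.J_fix {d : ℕ} (i c : Fin d) (h : (c : ℕ) = i + 1) (j : ℕ) (h1 : j ≠ i) (h2 : j ≠ i + 1) :
    PA.phi (Equiv.swap i c) (PA.J d j) = PA.J d j := by
  by_cases hj : j < d
  · have := PA.phi_J_fix (Equiv.swap i c) ⟨j, hj⟩ ?_ ?_
    · exact this
    · apply Equiv.swap_apply_of_ne_of_ne <;> (simp [Fin.ext_iff]; omega)
    · intro b
      by_cases h3 : b = i
      · subst h3; rw [Equiv.swap_apply_left]; simp only [Fin.lt_def]; omega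
      by_cases h4 : b = c
      · subst h4; rw [Equiv.swap_apply_right]; simp only [Fin.lt_def]; omega
      rw [Equiv.swap_apply_of_ne_of_ne h3 h4]
  · rw [PA.J_big j (by omega), map_zero]

noncomputable def PM.wd {d n : ℕ} (τ : Fin n → Equiv.Perm (Fin d)) : PM d :=
  ⟨Subgroup.closure (Set.range τ), (List.ofFn τ).reverse.prod⟩

theorem PM.wd_zero {d : ℕ} (τ : Fin 0 → Equiv.Perm (Fin d)) : PM.wd τ = 1 := by
  simp [PM.wd, PM.one_def]

theorem PM.wd_snoc {d n : ℕ} (τ : Fin n → Equiv.Perm (Fin d)) (t : Equiv.Perm (Fin d)) :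
    PM.wd (Fin.snoc τ t : Fin (n+1) → Equiv.Perm (Fin d)) = PM.y t * PM.wd τ := by
  refine PM.ext ?_ ?_
  · simp only [PM.wd, PM.mul_def, PM.y]
    rw [← Subgroup.closure_union]
    congr 1
    ext g
    simp only [Set.mem_range, Set.mem_union, Set.mem_singleton_iff]
    constructor
    · rintro ⟨i, rfl⟩
      induction i using Fin.lastCases with
      | last => left; simp
      | cast i => right; exact ⟨i, by simp⟩
    · rintro (rfl | ⟨i, rfl⟩)
      · exact ⟨Fin.last n, by simp⟩
      · exact ⟨i.castSucc, by simp⟩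
  · simp only [PM.wd, PM.mul_def, PM.y]
    rw [List.ofFn_succ']
    simp

theorem sum_snoc {d n : ℕ} {B : Type*} [AddCommMonoid B]
    (f : (Fin (n+1) → Equiv.Perm (Fin d)) → B) :
    ∑ τ, f τ = ∑ t : Equiv.Perm (Fin d), ∑ τ : Fin n → Equiv.Perm (Fin d), f (Fin.snoc τ t) := by
  rw [← Fintype.sum_prod_type']
  exact (Fintype.sum_equiv (Fin.snocEquiv (fun _ => Equiv.Perm (Fin d))) _ _ (fun _ => rfl)).symm

def S1 {d n : ℕ} (ε k : ℕ) (τ : Fin n → Equiv.Perm (Fin d)) : Prop :=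
  (∀ i, (τ i).IsSwap ∧ permTop (τ i) < k) ∧ ∀ i j, i < j → permTop (τ i) < permTop (τ j) + ε

def S2 {d n : ℕ} (ε N : ℕ) (τ : Fin n → Equiv.Perm (Fin d)) : Prop :=
  (∀ i, (τ i).IsSwap) ∧ ∀ i j : Fin n, i < j → (j : ℕ) < N → permTop (τ i) < permTop (τ j) + ε

theorem S1_snoc {d n : ℕ} (ε k : ℕ) (hε : ε = 0 ∨ ε = 1) (τ : Fin n → Equiv.Perm (Fin d))
    (t : Equiv.Perm (Fin d)) :
    S1 ε k (Fin.snoc τ t : Fin (n+1) → Equiv.Perm (Fin d)) ↔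
      (t.IsSwap ∧ permTop t < k) ∧ S1 ε (permTop t + ε) τ := by
  simp only [S1, Fin.forall_fin_succ', Fin.snoc_castSucc, Fin.snoc_last, Fin.castSucc_lt_castSucc_iff,
    Fin.castSucc_lt_last, lt_irrefl, true_imp_iff, false_imp_iff]
  have hl : ∀ i : Fin n, ¬ Fin.last n < i.castSucc := fun i => by simp [Fin.le_last]
  constructor
  · rintro ⟨⟨h1, h2⟩, h3, h4⟩
    exact ⟨h2, fun i => ⟨(h1 i).1, (h3 i).2⟩, fun i j => (h3 i).1 j⟩
  · rintro ⟨h2, h1, h3⟩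
    refine ⟨⟨fun i => ⟨(h1 i).1, ?_⟩, h2⟩, fun i => ⟨h3 i, (h1 i).2⟩, ?_⟩
    · have := (h1 i).2
      omega
    · simp [hl]

theorem S2_snoc {d n : ℕ} (ε N : ℕ) (hn : N ≤ n) (τ : Fin n → Equiv.Perm (Fin d))
    (t : Equiv.Perm (Fin d)) :
    S2 ε N (Fin.snoc τ t : Fin (n+1) → Equiv.Perm (Fin d)) ↔ t.IsSwap ∧ S2 ε N τ := by
  simp only [S2, Fin.forall_fin_succ', Fin.snoc_castSucc, Fin.snoc_last, Fin.castSucc_lt_castSucc_iff,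
    Fin.castSucc_lt_last, lt_irrefl, true_imp_iff, false_imp_iff, Fin.val_castSucc, Fin.val_last]
  have hl : ∀ i : Fin n, ¬ Fin.last n < i.castSucc := fun i => by simp [Fin.le_last]
  have hN : ¬ n < N := by omega
  simp only [hl, hN, false_imp_iff, and_true, implies_true]
  tauto

theorem permTop_lt {d : ℕ} {t : Equiv.Perm (Fin d)} (ht : t.IsSwap) : permTop t < d := by
  obtain ⟨a, b, hab, rfl⟩ := ht
  rcases lt_or_gt_of_ne hab with h | h
  · rw [permTop_swap a b h]; omega
  · rw [Equiv.swap_comm, permTop_swap b a h]; omega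

theorem S1_iff_S2 {d n : ℕ} (ε : ℕ) (τ : Fin n → Equiv.Perm (Fin d)) :
    S2 ε n τ ↔ S1 ε d τ := by
  constructor
  · rintro ⟨h1, h2⟩
    exact ⟨fun i => ⟨h1 i, permTop_lt (h1 i)⟩, fun i j h => h2 i j h j.2⟩
  · rintro ⟨h1, h2⟩
    exact ⟨fun i => (h1 i).1, fun i j h _ => h2 i j h⟩

open Classical in
noncomputable def PA.F (d ε n k : ℕ) : PA d :=
  ∑ τ : Fin n → Equiv.Perm (Fin d), if S1 ε k τ then PA.X (PM.wd τ) else 0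

open Classical in
noncomputable def PA.Z (d ε N n : ℕ) : PA d :=
  ∑ τ : Fin n → Equiv.Perm (Fin d), if S2 ε N τ then PA.X (PM.wd τ) else 0

theorem PA.F_zero (d ε k : ℕ) : PA.F d ε 0 k = 1 := by
  classical
  rw [PA.F, Fintype.sum_eq_single (default)]
  · rw [if_pos (by constructor <;> exact fun i => i.elim0), PM.wd_zero, PA.X_one]
  · intro x hx; exact absurd (Subsingleton.elim _ _) hx

open Classical in
theorem PA.F_rec (d ε n k : ℕ) (hε : ε = 0 ∨ ε = 1) : PA.F d ε (n+1) k =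
    ∑ t : Equiv.Perm (Fin d), if t.IsSwap ∧ permTop t < k then
      PA.x t * PA.F d ε n (permTop t + ε) else 0 := by
  rw [PA.F, sum_snoc]
  refine Finset.sum_congr rfl fun t _ => ?_
  simp only [S1_snoc ε k hε, PM.wd_snoc, PA.X_mul]
  split_ifs with h
  · simp only [h, true_and, and_self, PA.F, Finset.mul_sum, mul_ite, mul_zero, PA.x]
  · simp [h]

theorem PA.F_succ_zero (d ε n : ℕ) (hε : ε = 0 ∨ ε = 1) : PA.F d ε (n+1) 0 = 0 := by
  rw [PA.F_rec d ε n 0 hε]; simp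

theorem PA.F_succ_succ (d ε n k : ℕ) (hε : ε = 0 ∨ ε = 1) :
    PA.F d ε (n+1) (k+1) = PA.F d ε (n+1) k + PA.J d k * PA.F d ε n (k + ε) := by
  classical
  rw [PA.F_rec d ε n _ hε, PA.F_rec d ε n _ hε, PA.J, Finset.sum_mul, ← Finset.sum_add_distrib]
  refine Finset.sum_congr rfl fun t _ => ?_
  by_cases ht : t.IsSwap
  · rcases lt_trichotomy (permTop t) k with h | h | h
    · simp [ht, h, h.ne, Nat.lt_succ_of_lt h]
    · simp [ht, h]
    · have h1 : ¬ permTop t < k + 1 := by omega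
      have h2 : ¬ permTop t < k := by omega
      simp [ht, h1, h2, h.ne']
  · simp [ht]

theorem PA.Z_eq_F (d ε n : ℕ) : PA.Z d ε n n = PA.F d ε n d := by
  classical
  simp only [PA.Z, PA.F, S1_iff_S2]

theorem PA.Z_succ (d ε N n : ℕ) (hε : ε = 0 ∨ ε = 1) (hn : N ≤ n) :
    PA.Z d ε N (n+1) = PA.F d ε 1 d * PA.Z d ε N n := by
  classical
  have h0 := PA.F_rec d ε 0 d hε
  rw [Nat.zero_add] at h0
  rw [PA.Z, sum_snoc, h0, Finset.sum_mul]
  refine Finset.sum_congr rfl fun t _ => ?_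
  simp only [S2_snoc ε N hn, PM.wd_snoc, PA.X_mul, PA.F_zero, mul_one]
  by_cases h : t.IsSwap
  · simp only [h, permTop_lt h, true_and, and_self, if_true, PA.Z, Finset.mul_sum, mul_ite,
      mul_zero, PA.x]
  · simp [h]

theorem PA.Z_inv_adj (d ε N r : ℕ) (hε : ε = 0 ∨ ε = 1) (i c : Fin d) (h : (c : ℕ) = i + 1) :
    PA.phi (Equiv.swap i c) (PA.Z d ε N (N + r)) = PA.Z d ε N (N + r) := by
  have key := ci_abstract (PA.phi (Equiv.swap i c)) (PA.J d) (PA.F d ε) ε i hε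
    (PA.J_fix i c h)
    (by rw [← h, map_add, PA.phi_J_i i c h, PA.phi_J_c i c h]; abel)
    (by rw [← h, PA.J_prod i c h])
    (by rw [← h, PA.J_comm i c (by rw [Fin.lt_def]; omega)])
    (PA.F_zero d ε) (fun n => PA.F_succ_zero d ε n hε) (fun n k => PA.F_succ_succ d ε n k hε)
  have hd : d ≠ i + 1 := by omega
  induction r with
  | zero => rw [Nat.add_zero, PA.Z_eq_F, key _ _ hd]
  | succ r ih => rw [← Nat.add_assoc, PA.Z_succ d ε N _ hε (by omega), map_mul, ih, key _ _ hd]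

theorem PA.Z_inv (d ε N r : ℕ) (hd : 0 < d) (hε : ε = 0 ∨ ε = 1) (s : Equiv.Perm (Fin d)) :
    PA.phi s (PA.Z d ε N (N + r)) = PA.Z d ε N (N + r) := by
  obtain ⟨m, rfl⟩ : ∃ m, d = m + 1 := ⟨d - 1, by omega⟩
  have hs : s ∈ Submonoid.closure (Set.range fun i : Fin m ↦ Equiv.swap i.castSucc i.succ) := by
    rw [Equiv.Perm.mclosure_swap_castSucc_succ]; trivial
  induction hs using Submonoid.closure_induction with
  | mem x hx =>
    obtain ⟨i, rfl⟩ := hx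
    exact PA.Z_inv_adj _ ε N r hε _ _ (by simp)
  | one => exact PA.phi_one _
  | mul x y _ _ hx hy => rw [PA.phi_mul, hy, hx]

theorem S2_of_mon {d p q r : ℕ} (hpq : p = 0 ∨ q = 0) : ∃ ε, (ε = 0 ∨ ε = 1) ∧
    ∀ τ : Fin (p + q + r) → Equiv.Perm (Fin d),
      ((∀ i, (τ i).IsSwap) ∧ MonCond p q τ) ↔ S2 ε (p + q) τ := by
  have gen : ∀ ε, (ε = 0 ∨ ε = 1) → ∀ τ : Fin (p + q + r) → Equiv.Perm (Fin d),
      (∀ i j : Fin (p+q+r), (j : ℕ) = i + 1 → (j : ℕ) < p + q → permTop (τ i) < permTop (τ j) + ε) →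
      ∀ i j : Fin (p+q+r), i < j → (j : ℕ) < p + q → permTop (τ i) < permTop (τ j) + ε := by
    intro ε hε τ h i j
    obtain ⟨j, hj⟩ := j
    induction j with
    | zero => intro hij; exact absurd hij (by simp [Fin.lt_def])
    | succ j ih =>
      intro hij hjN
      have hij : (i : ℕ) < j + 1 := hij
      have h1 := h ⟨j, by omega⟩ ⟨j+1, hj⟩ rfl hjN
      by_cases hi : (i : ℕ) = j
      · have : i = ⟨j, by omega⟩ := Fin.ext hi
        rw [this]; exact h1
      · have := ih (by omega) (show (i : ℕ) < j by omega) (show j < p + q by simp at hjN; omega)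
        omega
  rcases hpq with rfl | rfl
  · refine ⟨0, Or.inl rfl, fun τ => ?_⟩
    refine and_congr_right fun _ => ⟨fun h => gen 0 (Or.inl rfl) τ fun i j hij hj => ?_,
      fun h i j hij => ⟨by omega, fun _ h2 => ?_⟩⟩
    · exact (h i j hij).2 (by omega) (by omega)
    · exact h i j (by rw [Fin.lt_def]; omega) (by omega)
  · refine ⟨1, Or.inr rfl, fun τ => ?_⟩
    refine and_congr_right fun _ => ⟨fun h => gen 1 (Or.inr rfl) τ fun i j hij hj => ?_,
      fun h i j hij => ⟨fun h2 => ?_, by omega⟩⟩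
    · have := (h i j hij).1 (by omega)
      omega
    · have := h i j (by rw [Fin.lt_def]; omega) (by omega)
      omega

/-- The residual condition on the word. -/
def PP {d : ℕ} (m : Multiset ℕ) (σ : Equiv.Perm (Fin d)) (a : PM d) : Prop :=
  fullCycleType (a.g * σ)⁻¹ = m ∧ ∀ x y : Fin d, ∃ g ∈ Subgroup.closure {σ} ⊔ a.H, g x = y

theorem fullCycleType_conj {d : ℕ} (s t : Equiv.Perm (Fin d)) :
    fullCycleType (s * t * s⁻¹) = fullCycleType t := by
  rw [fullCycleType, fullCycleType, Equiv.Perm.cycleType_conj, Equiv.Perm.card_support_conj]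

theorem PP_conj {d : ℕ} (m : Multiset ℕ) (s σ : Equiv.Perm (Fin d)) (a : PM d) :
    PP m (s * σ * s⁻¹) (PM.conj s a) ↔ PP m σ a := by
  have h1 : ((PM.conj s a).g * (s * σ * s⁻¹))⁻¹ = s * (a.g * σ)⁻¹ * s⁻¹ := by
    simp [PM.conj_apply, mul_assoc]
  have h2 : Subgroup.closure {s * σ * s⁻¹} ⊔ (PM.conj s a).H =
      (Subgroup.closure {σ} ⊔ a.H).map (MulAut.conj s).toMonoidHom := by
    simp [PM.conj_apply, Subgroup.map_sup, MonoidHom.map_closure]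
  rw [PP, PP, h1, h2, fullCycleType_conj]
  refine and_congr_right fun _ => ⟨fun h x y => ?_, fun h x y => ?_⟩
  · obtain ⟨_, ⟨g, hg, rfl⟩, e⟩ := h (s x) (s y)
    exact ⟨g, hg, by simpa using e⟩
  · obtain ⟨g, hg, e⟩ := h (s⁻¹ x) (s⁻¹ y)
    exact ⟨_, ⟨g, hg, rfl⟩, by
      change s (g (s⁻¹ x)) = y
      rw [e]; simp⟩

open Classical in
noncomputable def Lam {d : ℕ} (m : Multiset ℕ) (σ : Equiv.Perm (Fin d)) : PA d →+ ℤ :=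
  MonoidAlgebra.liftNC (AddMonoidHom.id ℤ) (fun a => if PP m σ a then 1 else 0)

open Classical in
theorem Lam_X {d : ℕ} (m : Multiset ℕ) (σ : Equiv.Perm (Fin d)) (a : PM d) :
    Lam m σ (PA.X a) = if PP m σ a then 1 else 0 := by
  simp [Lam, PA.X]

theorem Lam_phi {d : ℕ} (m : Multiset ℕ) (s σ : Equiv.Perm (Fin d)) (z : PA d) :
    Lam m (s * σ * s⁻¹) (PA.phi s z) = Lam m σ z := by
  classical
  induction z using MonoidAlgebra.induction_linear with
  | zero => simp
  | add f g hf hg => rw [map_add, map_add, hf, hg, map_add]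
  | single a r =>
    have : (MonoidAlgebra.single a r : PA d) = r • PA.X a := by simp [PA.X]
    rw [this, map_zsmul, map_zsmul, map_zsmul, PA.phi_X, Lam_X, Lam_X]
    simp only [PP_conj]

theorem count_eq {d p q r ε : ℕ} (m : Multiset ℕ)
    (hS : ∀ τ : Fin (p + q + r) → Equiv.Perm (Fin d),
      ((∀ i, (τ i).IsSwap) ∧ MonCond p q τ) ↔ S2 ε (p + q) τ) (σ : Equiv.Perm (Fin d)) :
    (Nat.card { t : (Fin (p + q + r) → Equiv.Perm (Fin d)) × Equiv.Perm (Fin d) //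
        (∀ i, (t.1 i).IsSwap) ∧ MonCond p q t.1 ∧
        fullCycleType t.2 = m ∧
        t.2 * (List.ofFn t.1).reverse.prod * σ = 1 ∧
        (∀ x y : Fin d, ∃ g ∈ Subgroup.closure
          ({σ, t.2} ∪ Set.range t.1 : Set (Equiv.Perm (Fin d))), g x = y) } : ℤ) =
    Lam m σ (PA.Z d ε (p + q) (p + q + r)) := by
  classical
  have hcl : ∀ (τ : Fin (p + q + r) → Equiv.Perm (Fin d)),
      Subgroup.closure ({σ, ((List.ofFn τ).reverse.prod * σ)⁻¹} ∪ Set.range τ) =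
        Subgroup.closure {σ} ⊔ Subgroup.closure (Set.range τ) := by
    intro τ
    rw [← Subgroup.closure_union]
    apply le_antisymm
    · rw [Subgroup.closure_le]
      have hσ : σ ∈ Subgroup.closure ({σ} ∪ Set.range τ) := Subgroup.subset_closure (Or.inl rfl)
      have hτ : ∀ i, τ i ∈ Subgroup.closure ({σ} ∪ Set.range τ) :=
        fun i => Subgroup.subset_closure (Or.inr ⟨i, rfl⟩)
      rintro g ((rfl | rfl) | ⟨i, rfl⟩)
      · exact hσ
      · refine inv_mem (mul_mem (list_prod_mem ?_) hσ)
        intro x hx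
        simp only [List.mem_reverse, List.mem_ofFn] at hx
        obtain ⟨i, rfl⟩ := hx
        exact hτ i
      · exact hτ i
    · apply Subgroup.closure_mono
      rintro g (rfl | h)
      · exact Or.inl (Or.inl rfl)
      · exact Or.inr h
  have e : { t : (Fin (p + q + r) → Equiv.Perm (Fin d)) × Equiv.Perm (Fin d) //
        (∀ i, (t.1 i).IsSwap) ∧ MonCond p q t.1 ∧
        fullCycleType t.2 = m ∧
        t.2 * (List.ofFn t.1).reverse.prod * σ = 1 ∧
        (∀ x y : Fin d, ∃ g ∈ Subgroup.closure
          ({σ, t.2} ∪ Set.range t.1 : Set (Equiv.Perm (Fin d))), g x = y) } ≃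
      { τ : Fin (p + q + r) → Equiv.Perm (Fin d) // S2 ε (p + q) τ ∧ PP m σ (PM.wd τ) } :=
    { toFun := fun t => ⟨t.1.1, by
        obtain ⟨⟨τ, u⟩, h1, h2, h3, h4, h5⟩ := t
        dsimp only at *
        have hu : u = ((List.ofFn τ).reverse.prod * σ)⁻¹ :=
          eq_inv_of_mul_eq_one_left (by rw [← mul_assoc]; exact h4)
        subst hu
        rw [hcl] at h5
        exact ⟨(hS τ).1 ⟨h1, h2⟩, h3, h5⟩⟩
      invFun := fun τ => ⟨(τ.1, ((List.ofFn τ.1).reverse.prod * σ)⁻¹), by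
        obtain ⟨τ, h1, h3, h5⟩ := τ
        have h := (hS τ).2 h1
        refine ⟨h.1, h.2, h3, ?_, ?_⟩
        · rw [mul_assoc]; exact inv_mul_cancel _
        · dsimp only
          rw [hcl]; exact h5⟩
      left_inv := by
        rintro ⟨⟨τ, u⟩, h1, h2, h3, h4, h5⟩
        apply Subtype.ext
        refine Prod.ext rfl ?_
        exact (eq_inv_of_mul_eq_one_left (by rw [← mul_assoc]; exact h4)).symm
      right_inv := fun τ => rfl }
  rw [Nat.card_congr e, Nat.card_eq_fintype_card, Fintype.card_subtype, PA.Z, map_sum,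
    Finset.card_filter, Nat.cast_sum]
  refine Finset.sum_congr rfl fun τ _ => ?_
  by_cases h : S2 ε (p + q) τ
  · simp [h, Lam_X]
  · simp [h]

/-- The count `K°(σ)` of tuples `(τ₁,…,τ_b,σ₂)` with each `τᵢ` a transposition,
`(τ₁,…,τ_b)` satisfying the `(p,q)`-monotonicity condition, the cycle type of `σ₂`
equal to `ν`, `σ₂·τ_b⋯τ₁·σ = id`, and the subgroup generated by `σ, τ₁,…,τ_b, σ₂`
acting transitively on `{1,…,d}`, does not change when `σ` is replaced by a
conjugate permutation (here `p = 0` or `q = 0`, `b = p + q + r`, and `ν` is an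
ordered partition of `d`). -/
theorem conjugation_invariance_of_transitive_interpolated_count
    (d p q r : ℕ) (hd : 0 < d) (hpq : p = 0 ∨ q = 0)
    (n : ℕ) (ν : Fin n → ℕ) (hν : ∀ j, 0 < ν j) (hνsum : ∑ j, ν j = d)
    (σ σ' : Equiv.Perm (Fin d)) (hconj : IsConj σ σ') :
    Nat.card { t : (Fin (p + q + r) → Equiv.Perm (Fin d)) × Equiv.Perm (Fin d) //
        (∀ i, (t.1 i).IsSwap) ∧ MonCond p q t.1 ∧
        fullCycleType t.2 = (List.ofFn ν : Multiset ℕ) ∧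
        t.2 * (List.ofFn t.1).reverse.prod * σ = 1 ∧
        (∀ x y : Fin d, ∃ g ∈ Subgroup.closure
          ({σ, t.2} ∪ Set.range t.1 : Set (Equiv.Perm (Fin d))), g x = y) } =
    Nat.card { t : (Fin (p + q + r) → Equiv.Perm (Fin d)) × Equiv.Perm (Fin d) //
        (∀ i, (t.1 i).IsSwap) ∧ MonCond p q t.1 ∧
        fullCycleType t.2 = (List.ofFn ν : Multiset ℕ) ∧
        t.2 * (List.ofFn t.1).reverse.prod * σ' = 1 ∧
        (∀ x y : Fin d, ∃ g ∈ Subgroup.closure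
          ({σ', t.2} ∪ Set.range t.1 : Set (Equiv.Perm (Fin d))), g x = y) } := by
  obtain ⟨ε, hε, hS⟩ := S2_of_mon (d := d) (r := r) hpq
  obtain ⟨s, rfl⟩ := isConj_iff.1 hconj
  have h1 := count_eq (List.ofFn ν : Multiset ℕ) hS σ
  have h2 := count_eq (List.ofFn ν : Multiset ℕ) hS (s * σ * s⁻¹)
  rw [← PA.Z_inv d ε (p + q) r hd hε s, Lam_phi] at h2
  exact_mod_cast h1.trans h2.symm
end

section
/- Let d ≥ 1 and q ≥ 0 be integers. In the group algebra ℚ[S_d], the element Z'_q := Σ τ_q·τ_{q−1}⋯τ₁, where the sum runs over all tuples (τ₁,…,τ_q) of transpositions in S_d with top(τ₁) < top(τ₂) < … < top(τ_q), lies in the center of ℚ[S_d], i.e. Z'_q commutes with every element of ℚ[S_d]. (Equivalently, Z'_q equals the elementary symmetric polynomial e_q evaluated at the Jucys–Murphy elements J₂,…,J_d, where J_i = Σ_{j<i} (j i), and symmetric polynomials in the Jucys–Murphy elements are central.) -/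
open scoped Classical in
/-- The element `Z'_q = Σ τ_q·τ_{q−1}⋯τ₁` of the group algebra `ℚ[S_d]`, where the sum
runs over all tuples `(τ₁,…,τ_q)` of transpositions with
`top τ₁ < top τ₂ < … < top τ_q`. -/
noncomputable def strictlyMonotoneSum (d q : ℕ) :
    MonoidAlgebra ℚ (Equiv.Perm (Fin d)) :=
  ∑ τ : Fin q → Equiv.Perm (Fin d),
    if (∀ i, (τ i).IsSwap) ∧
        (∀ i j : Fin q, (j : ℕ) = (i : ℕ) + 1 → permTop (τ i) < permTop (τ j))
    then MonoidAlgebra.single ((List.ofFn τ).reverse.prod) (1 : ℚ) else 0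

namespace JMaux

/-- Abstract elementary symmetric recursion. -/
def E {A : Type*} [Ring A] (J : ℕ → A) : ℕ → ℕ → A
  | _, 0 => 1
  | 0, _ + 1 => 0
  | k + 1, q + 1 => E J k (q + 1) + J k * E J k q

theorem E_zero {A : Type*} [Ring A] (J : ℕ → A) (k : ℕ) : E J k 0 = 1 := by
  cases k <;> simp [E]

theorem E_sum {A : Type*} [Ring A] (J : ℕ → A) (k q : ℕ) :
    E J k (q + 1) = ∑ m ∈ Finset.range k, J m * E J m q := by
  induction k with
  | zero => simp [E]
  | succ k ih => rw [E, ih, Finset.sum_range_succ]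

theorem E_comm {A : Type*} [Ring A] (J : ℕ → A) (s : A) (a : ℕ)
    (h1 : ∀ i, i ≠ a → i ≠ a + 1 → s * J i = J i * s)
    (h2 : s * J (a + 1) = J a * s + 1)
    (h3 : s * J a = J (a + 1) * s - 1)
    (h4 : J a * J (a + 1) = J (a + 1) * J a) (k : ℕ) :
    ∀ q, (k ≠ a + 1) → s * E J k q = E J k q * s := by
  induction k using Nat.strong_induction_on with
  | _ k ih =>
  intro q hk
  cases q with
  | zero => simp [E_zero]
  | succ q =>
  cases k with
  | zero => simp [E]
  | succ k =>
  by_cases hka : k = a + 1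
  · subst hka
    have c := fun q => ih a (by omega) q (by omega)
    have hs : s * (J a + J (a + 1)) = (J a + J (a + 1)) * s := by
      rw [mul_add, h2, h3]; noncomm_ring
    have hp : s * (J (a + 1) * J a) = (J (a + 1) * J a) * s := by
      rw [← mul_assoc, h2, add_mul, mul_assoc, h3, ← h4]; noncomm_ring
    cases q with
    | zero =>
      have : E J (a + 1 + 1) (0 + 1) = E J a 1 + (J a + J (a + 1)) := by
        simp only [E, E_zero]; noncomm_ring
      rw [this, mul_add, add_mul, hs, c]
    | succ q =>
      have : E J (a + 1 + 1) (q + 1 + 1) = E J a (q + 2) + (J a + J (a + 1)) * E J a (q + 1)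
          + (J (a + 1) * J a) * E J a q := by
        simp only [E]; noncomm_ring
      rw [this]
      simp only [mul_add s, add_mul _ _ s]
      rw [c, ← mul_assoc, hs, ← mul_assoc s, hp]
      simp only [mul_assoc, c]
  · rw [E, mul_add, add_mul, ← mul_assoc, h1 k (by omega) (by omega), ih k (by omega) _ (by omega),
      mul_assoc, ih k (by omega) _ (by omega), mul_assoc]

theorem permTop_swap {d : ℕ} {a b : Fin d} (h : a < b) :
    permTop (Equiv.swap a b) = b := by
  rw [permTop, Equiv.Perm.support_swap h.ne]
  simp [h.le]

theorem swap_form {d : ℕ} {τ : Equiv.Perm (Fin d)} (h : τ.IsSwap) :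
    ∃ a b, a < b ∧ τ = Equiv.swap a b := by
  obtain ⟨a, b, hab, rfl⟩ := h
  rcases lt_or_gt_of_ne hab with h | h
  · exact ⟨a, b, h, rfl⟩
  · exact ⟨b, a, h, Equiv.swap_comm _ _⟩

open scoped Classical in
noncomputable def J (d : ℕ) (m : ℕ) : MonoidAlgebra ℚ (Equiv.Perm (Fin d)) :=
  ∑ τ : Equiv.Perm (Fin d), if τ.IsSwap ∧ permTop τ = m then MonoidAlgebra.single τ 1 else 0

theorem J_big {d m : ℕ} (h : d ≤ m) : J d m = 0 := by
  unfold J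
  refine Finset.sum_eq_zero fun τ _ => if_neg ?_
  rintro ⟨h1, h2⟩
  obtain ⟨a, b, hab, rfl⟩ := swap_form h1
  rw [permTop_swap hab] at h2
  omega

theorem J_eq {d : ℕ} (k : Fin d) :
    J d k = ∑ j ∈ Finset.Iio k, MonoidAlgebra.single (Equiv.swap j k) (1 : ℚ) := by
  classical
  unfold J
  rw [← Finset.sum_filter]
  symm
  refine Finset.sum_bij (fun j _ => Equiv.swap j k) ?_ ?_ ?_ ?_
  · intro j hj
    rw [Finset.mem_Iio] at hj
    simp only [Finset.mem_filter, Finset.mem_univ, true_and]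
    exact ⟨⟨j, k, hj.ne, rfl⟩, permTop_swap hj⟩
  · intro j _ j' _ h
    have := congrArg (fun σ : Equiv.Perm (Fin d) => σ k) h
    simpa using this
  · intro τ hτ
    simp only [Finset.mem_filter, Finset.mem_univ, true_and] at hτ
    obtain ⟨h1, h2⟩ := hτ
    obtain ⟨a, b, hab, rfl⟩ := swap_form h1
    rw [permTop_swap hab] at h2
    have : b = k := Fin.ext h2
    subst this
    exact ⟨a, by simpa using hab, rfl⟩
  · intros; rfl

theorem J_comm {d : ℕ} (k : Fin d) (g : Equiv.Perm (Fin d)) (hk : g k = k)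
    (hg : ∀ j, j < k ↔ g j < k) :
    MonoidAlgebra.single g (1 : ℚ) * J d k = J d k * MonoidAlgebra.single g 1 := by
  rw [J_eq, Finset.mul_sum, Finset.sum_mul]
  refine Finset.sum_equiv g (by simpa using hg) ?_
  intro j _
  rw [MonoidAlgebra.single_mul_single, MonoidAlgebra.single_mul_single, Equiv.mul_swap_eq_swap_mul, hk]

theorem J_comm_swap {d : ℕ} (k a b : Fin d) (h : (a < k ∧ b < k) ∨ (k < a ∧ k < b)) :
    MonoidAlgebra.single (Equiv.swap a b) (1 : ℚ) * J d k
      = J d k * MonoidAlgebra.single (Equiv.swap a b) 1 := by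
  apply J_comm
  · apply Equiv.swap_apply_of_ne_of_ne <;> rintro rfl <;> simp at h
  · intro j
    rw [Equiv.swap_apply_def]
    split_ifs with h1 h2
    · subst h1; constructor <;> intro <;> omega
    · subst h2; constructor <;> intro <;> omega
    · rfl

theorem JJ {d : ℕ} (a b : Fin d) (h : a < b) : J d a * J d b = J d b * J d a := by
  rw [J_eq a, Finset.mul_sum, Finset.sum_mul]
  refine Finset.sum_congr rfl fun j hj => ?_
  rw [Finset.mem_Iio] at hj
  exact J_comm_swap _ _ _ (Or.inl ⟨hj.trans h, h⟩)

theorem Iio_succ {d : ℕ} (a b : Fin d) (h : (b : ℕ) = a + 1) :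
    Finset.Iio b = insert a (Finset.Iio a) := by
  ext x; simp only [Finset.mem_Iio, Finset.mem_insert, Fin.lt_def, Fin.ext_iff]; omega

theorem h2 {d : ℕ} (a b : Fin d) (h : (b : ℕ) = a + 1) :
    MonoidAlgebra.single (Equiv.swap a b) (1 : ℚ) * J d b
      = J d a * MonoidAlgebra.single (Equiv.swap a b) 1 + 1 := by
  rw [J_eq, J_eq, Iio_succ a b h, Finset.sum_insert (by simp), mul_add, add_comm,
    Finset.mul_sum, Finset.sum_mul]
  congr 1
  · refine Finset.sum_congr rfl fun j hj => ?_
    rw [Finset.mem_Iio] at hj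
    rw [MonoidAlgebra.single_mul_single, MonoidAlgebra.single_mul_single,
      Equiv.mul_swap_eq_swap_mul, Equiv.swap_apply_right,
      Equiv.swap_apply_of_ne_of_ne hj.ne (by rintro rfl; omega)]
  · rw [MonoidAlgebra.single_mul_single, Equiv.swap_mul_self, mul_one, MonoidAlgebra.one_def]

theorem h3 {d : ℕ} (a b : Fin d) (h : (b : ℕ) = a + 1) :
    MonoidAlgebra.single (Equiv.swap a b) (1 : ℚ) * J d a
      = J d b * MonoidAlgebra.single (Equiv.swap a b) 1 - 1 := by
  have ss : MonoidAlgebra.single (Equiv.swap a b) (1 : ℚ) *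
      MonoidAlgebra.single (Equiv.swap a b) (1 : ℚ) = 1 := by
    rw [MonoidAlgebra.single_mul_single, Equiv.swap_mul_self, mul_one, MonoidAlgebra.one_def]
  have := h2 a b h
  generalize MonoidAlgebra.single (Equiv.swap a b) (1 : ℚ) = s at *
  have e : s * (s * J d b) * s = s * (J d a * s + 1) * s := by rw [this]
  rw [← mul_assoc s s, ss, one_mul, mul_add, add_mul, mul_one, ss, mul_assoc s, mul_assoc, ss,
    mul_one] at e
  rw [e, add_sub_cancel_right]

open scoped Classical in
noncomputable def F (d k q : ℕ) : MonoidAlgebra ℚ (Equiv.Perm (Fin d)) :=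
  ∑ τ : Fin q → Equiv.Perm (Fin d),
    if ((∀ i, (τ i).IsSwap) ∧
        (∀ i j : Fin q, (j : ℕ) = (i : ℕ) + 1 → permTop (τ i) < permTop (τ j))) ∧
        ∀ i, permTop (τ i) < k
    then MonoidAlgebra.single ((List.ofFn τ).reverse.prod) (1 : ℚ) else 0

theorem cond_snoc {d k q : ℕ} (τ : Fin q → Equiv.Perm (Fin d)) (σ : Equiv.Perm (Fin d)) :
    (((∀ i, ((Fin.snoc τ σ : Fin (q + 1) → Equiv.Perm (Fin d)) i).IsSwap) ∧
        (∀ i j : Fin (q + 1), (j : ℕ) = (i : ℕ) + 1 →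
          permTop ((Fin.snoc τ σ : Fin (q + 1) → Equiv.Perm (Fin d)) i) <
          permTop ((Fin.snoc τ σ : Fin (q + 1) → Equiv.Perm (Fin d)) j))) ∧
        ∀ i, permTop ((Fin.snoc τ σ : Fin (q + 1) → Equiv.Perm (Fin d)) i) < k) ↔
    (σ.IsSwap ∧ permTop σ < k) ∧ (((∀ i, (τ i).IsSwap) ∧
        (∀ i j : Fin q, (j : ℕ) = (i : ℕ) + 1 → permTop (τ i) < permTop (τ j))) ∧
        ∀ i, permTop (τ i) < permTop σ) := by
  simp only [Fin.forall_fin_succ', Fin.snoc_castSucc, Fin.snoc_last, Fin.val_castSucc, Fin.val_last]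
  constructor
  · rintro ⟨⟨⟨a1, a2⟩, a3, a4⟩, a5, a6⟩
    refine ⟨⟨a2, a6⟩, ⟨a1, fun i => (a3 i).1⟩, ?_⟩
    have key : ∀ n (i : Fin q), (i : ℕ) + 1 + n = q → permTop (τ i) < permTop σ := by
      intro n
      induction n with
      | zero => intro i hi; exact (a3 i).2 (by omega)
      | succ n ih =>
        intro i hi
        exact ((a3 i).1 ⟨i + 1, by omega⟩ rfl).trans (ih ⟨i + 1, by omega⟩ (by simp; omega))
    exact fun i => key (q - (i + 1)) i (by omega)
  · rintro ⟨⟨a1, a2⟩, ⟨a3, a4⟩, a5⟩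
    refine ⟨⟨⟨a3, a1⟩, fun i => ⟨a4 i, fun _ => a5 i⟩, ?_, ?_⟩, fun i => (a5 i).trans a2, a2⟩
    · intro i hi; omega
    · intro hi; omega

theorem F_succ (d k q : ℕ) : F d k (q + 1) = ∑ m ∈ Finset.range k, J d m * F d m q := by
  classical
  have hR : ∀ m, J d m * F d m q = ∑ σ : Equiv.Perm (Fin d),
      if permTop σ = m then (if σ.IsSwap then
        MonoidAlgebra.single σ (1 : ℚ) * F d (permTop σ) q else 0) else 0 := by
    intro m
    rw [J, Finset.sum_mul]
    refine Finset.sum_congr rfl fun σ _ => ?_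
    by_cases h : permTop σ = m
    · subst h; simp
    · simp [h]
  simp only [hR]
  rw [Finset.sum_comm]
  simp only [Finset.sum_ite_eq, Finset.mem_range]
  rw [F, ← (Fin.snocEquiv (fun _ : Fin (q + 1) => Equiv.Perm (Fin d))).sum_comp,
    Fintype.sum_prod_type]
  refine Finset.sum_congr rfl fun σ _ => ?_
  simp only [Fin.snocEquiv, Equiv.coe_fn_mk]
  simp only [cond_snoc]
  by_cases h1 : permTop σ < k <;> by_cases h2 : σ.IsSwap <;> simp only [h1, h2, true_and, false_and,
    and_true, and_false, if_true, if_false, Finset.sum_const_zero]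
  rw [F, Finset.mul_sum]
  refine Finset.sum_congr rfl fun τ _ => ?_
  rw [mul_ite, mul_zero, MonoidAlgebra.single_mul_single, mul_one]
  congr 2
  rw [List.ofFn_succ']
  simp [List.concat_eq_append]

theorem F_eq (d q : ℕ) : ∀ k, F d k q = E (J d) k q := by
  induction q with
  | zero => intro k; rw [E_zero]; simp [F, MonoidAlgebra.one_def]
  | succ q ih => intro k; rw [F_succ, E_sum]; simp only [ih]

theorem Z_eq (d q : ℕ) : strictlyMonotoneSum d q = E (J d) d q := by
  classical
  rw [← F_eq, F, strictlyMonotoneSum]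
  refine Finset.sum_congr rfl fun τ _ => ?_
  refine if_congr ?_ rfl rfl
  refine ⟨fun h => ⟨h, fun i => ?_⟩, fun h => h.1⟩
  obtain ⟨a, b, hab, e⟩ := swap_form (h.1 i)
  rw [e, permTop_swap hab]
  exact b.2

theorem Z_adj (d q : ℕ) (a b : Fin d) (h : (b : ℕ) = a + 1) :
    MonoidAlgebra.single (Equiv.swap a b) (1 : ℚ) * strictlyMonotoneSum d q
      = strictlyMonotoneSum d q * MonoidAlgebra.single (Equiv.swap a b) 1 := by
  rw [Z_eq]
  refine E_comm (J d) _ a ?_ ?_ ?_ ?_ d q (by omega)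
  · intro i hi hi'
    by_cases hd : i < d
    · exact J_comm_swap ⟨i, hd⟩ a b (by simp only [Fin.lt_def]; omega)
    · rw [J_big (by omega)]; simp
  · rw [← h]; exact h2 a b h
  · rw [← h]; exact h3 a b h
  · rw [← h]; exact JJ a b (by rw [Fin.lt_def]; omega)

theorem Z_perm (d q : ℕ) (hd : 1 ≤ d) (g : Equiv.Perm (Fin d)) :
    Commute (MonoidAlgebra.single g (1 : ℚ)) (strictlyMonotoneSum d q) := by
  obtain ⟨n, rfl⟩ : ∃ n, d = n + 1 := ⟨d - 1, by omega⟩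
  have hg : g ∈ Submonoid.closure
      (Set.range fun i : Fin n => Equiv.swap i.castSucc i.succ) := by
    rw [Equiv.Perm.mclosure_swap_castSucc_succ]; trivial
  induction hg using Submonoid.closure_induction with
  | mem x hx =>
    obtain ⟨i, rfl⟩ := hx
    exact Z_adj _ _ _ _ (by simp)
  | one => rw [← MonoidAlgebra.one_def]; exact Commute.one_left _
  | mul x y _ _ hx hy =>
    have := hx.mul_left hy
    rwa [MonoidAlgebra.single_mul_single, mul_one] at this

end JMaux

/-- `Z'_q` lies in the center of the group algebra `ℚ[S_d]`: it commutes with every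
element of `ℚ[S_d]`. -/
theorem strictlyMonotoneSum_central (d q : ℕ) (hd : 1 ≤ d)
    (x : MonoidAlgebra ℚ (Equiv.Perm (Fin d))) :
    strictlyMonotoneSum d q * x = x * strictlyMonotoneSum d q := by
  induction x using MonoidAlgebra.induction_on with
  | of g => exact (JMaux.Z_perm d q hd g).eq.symm
  | add x y hx hy => rw [mul_add, add_mul, hx, hy]
  | smul r x hx => rw [mul_smul_comm, smul_mul_assoc, hx]
end

section
/- Fix integers s ≥ 2 and t with 1 ≤ t ≤ s. For positive integers μ and ω₂,…,ω_s, let N(μ, ω₂,…,ω_s) be the number of integer tuples (l₂,…,l_s) satisfying: 1 ≤ l₂ ≤ l₃ ≤ … ≤ l_t, l_t < l_{t+1} < … < l_s, l_k ≤ μ for all k, and max{1, μ − ω_k} ≤ l_k for all k ∈ {2,…,s}. Then N is piecewise polynomial in the following sense: for every choice of strict comparison data — namely, for each k ∈ {2,…,s} a declaration of whether ω_k < μ − 1 or ω_k > μ − 1, and for each pair 2 ≤ j < k ≤ s a declaration of whether ω_j < ω_k or ω_j > ω_k — there exists a polynomial P ∈ ℚ[x, y₂,…,y_s] such that N(μ,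 ω₂,…,ω_s) = P(μ, ω₂,…,ω_s) for all positive integers μ, ω₂,…,ω_s realizing exactly those strict comparisons. -/
/-- `N(μ, ω₂,…,ω_s)`: the number of integer tuples `(l₂,…,l_s)` (indexed here by
`Fin (s-1)`, with index `i` corresponding to `l_{i+2}`) satisfying
`1 ≤ l₂ ≤ l₃ ≤ … ≤ l_t`, `l_t < l_{t+1} < … < l_s`, `l_k ≤ μ` for all `k`, and
`max {1, μ − ω_k} ≤ l_k` for all `k ∈ {2,…,s}`. -/
noncomputable def chainPathCount (s t : ℕ) (μ : ℕ) (ω : Fin (s - 1) → ℕ) : ℕ :=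
  Nat.card { l : Fin (s - 1) → ℕ //
    (∀ i, 1 ≤ l i) ∧
    (∀ i, l i ≤ μ) ∧
    (∀ i, max 1 (μ - ω i) ≤ l i) ∧
    (∀ i j : Fin (s - 1), (j : ℕ) = (i : ℕ) + 1 →
      ((i : ℕ) + 3 ≤ t → l i ≤ l j) ∧ (t ≤ (i : ℕ) + 2 → l i < l j)) }

open Polynomial in
theorem aux_sum {R : Type*} [CommRing R] [Algebra ℚ R] (P : R[X]) :
    ∃ Q : R[X], ∀ (φ : R →+* ℚ) (x : ℚ),
      eval₂ φ (1 + x) Q - eval₂ φ x Q = eval₂ φ x P := by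
  induction P using Polynomial.induction_on' with
  | add p q hp hq =>
    obtain ⟨P', hP⟩ := hp
    obtain ⟨Q', hQ⟩ := hq
    refine ⟨P' + Q', fun φ x => ?_⟩
    rw [eval₂_add, eval₂_add, eval₂_add, ← hP, ← hQ]
    ring
  | monomial k r =>
    refine ⟨C (r * algebraMap ℚ R (1 / (k + 1 : ℚ))) *
      (Polynomial.bernoulli (k + 1)).map (algebraMap ℚ R), fun φ x => ?_⟩
    have h1 : φ.comp (algebraMap ℚ R) = RingHom.id ℚ := Subsingleton.elim _ _
    have h2 : ∀ y : ℚ, φ (algebraMap ℚ R y) = y := fun y => by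
      have := congrArg (fun f : ℚ →+* ℚ => f y) h1
      simpa using this
    have hk : (k + 1 : ℚ) ≠ 0 := by positivity
    simp only [eval₂_mul, eval₂_C, eval₂_map, h1, eval₂_id, eval₂_monomial, map_mul, h2]
    rw [Polynomial.bernoulli_eval_one_add]
    push_cast
    try simp only [Nat.add_sub_cancel]
    field_simp
    ring

open Polynomial in
theorem aux_sum_Ico {R : Type*} [CommRing R] [Algebra ℚ R] (P : R[X]) (e : ℕ) :
    ∃ Q : R[X], ∀ (φ : R →+* ℚ) (L m : ℕ), L ≤ m →
      ∑ z ∈ Finset.Ico L m, eval₂ φ ((z + e : ℕ) : ℚ) P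
        = eval₂ φ (m : ℚ) Q - eval₂ φ (L : ℚ) Q := by
  obtain ⟨Q, hQ⟩ := aux_sum (P.comp (X + C (e : R)))
  refine ⟨Q, fun φ L m h => ?_⟩
  induction m, h using Nat.le_induction with
  | base => simp
  | succ m hm ih =>
    rw [Finset.sum_Ico_succ_top hm, ih]
    have := hQ φ (m : ℚ)
    rw [eval₂_comp] at this
    rw [eval₂_add, eval₂_X, eval₂_C, map_natCast] at this
    push_cast
    rw [← this, add_comm (m : ℚ) 1]
    ring

/-- tuples of length `k` with entries below `m` -/
def auxS (a e : ℕ → ℕ) (k m : ℕ) (l : Fin k → ℕ) : Prop :=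
  (∀ i : Fin k, a i ≤ l i ∧ l i < m) ∧
    ∀ i j : Fin k, (j : ℕ) = (i : ℕ) + 1 → l i < l j + e j

/-- the number of such tuples -/
noncomputable def auxG (a e : ℕ → ℕ) (k m : ℕ) : ℕ := Nat.card {l : Fin k → ℕ // auxS a e k m l}

theorem auxS_finite (a e : ℕ → ℕ) (k m : ℕ) : Finite {l : Fin k → ℕ // auxS a e k m l} := by
  refine Finite.of_injective
    (fun l : {l : Fin k → ℕ // auxS a e k m l} => fun i => (⟨l.1 i, (l.2.1 i).2⟩ : Fin m)) ?_
  intro l l' h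
  ext i
  have := congrFun h i
  simpa using this

theorem auxS_mono {a e : ℕ → ℕ} (he : ∀ i, e i ≤ 1) {k m : ℕ} {l : Fin k → ℕ}
    (h : auxS a e k m l) : ∀ (d : ℕ) (i j : Fin k), (j : ℕ) = i + d → l i ≤ l j := by
  intro d
  induction d with
  | zero =>
    intro i j hij
    have : i = j := Fin.ext (by omega)
    rw [this]
  | succ d ih =>
    intro i j hij
    have h1 := ih i ⟨i + d, by omega⟩ rfl
    have h2 := h.2 ⟨i + d, by omega⟩ j (by simp; omega)
    have := he j
    omega

theorem auxS_succ {a e : ℕ → ℕ} (he : ∀ i, e i ≤ 1) {k m : ℕ} (l : Fin k → ℕ) (z : ℕ) :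
    auxS a e (k + 1) m (Fin.snoc l z : Fin (k + 1) → ℕ) ↔
      (a k ≤ z ∧ z < m) ∧ auxS a e k (z + e k) l := by
  constructor
  · intro h
    have hl := h.1 (Fin.last k)
    simp only [Fin.snoc_last, Fin.val_last] at hl
    refine ⟨hl, ?_, ?_⟩
    · intro i
      have h1 := h.1 i.castSucc
      simp only [Fin.snoc_castSucc, Fin.val_castSucc] at h1
      refine ⟨h1.1, ?_⟩
      have hi := i.2
      obtain ⟨k', rfl⟩ : ∃ k', k = k' + 1 := ⟨k - 1, by omega⟩
      have h2 := auxS_mono he h (k' - i) i.castSucc (Fin.last k').castSucc (by simp; omega)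
      have h3 := h.2 (Fin.last k').castSucc (Fin.last (k' + 1)) (by simp)
      simp only [Fin.snoc_castSucc, Fin.snoc_last, Fin.val_last] at h2 h3
      omega
    · intro i j hij
      have := h.2 i.castSucc j.castSucc (by simpa using hij)
      simpa only [Fin.snoc_castSucc, Fin.val_castSucc] using this
  · rintro ⟨hz, h⟩
    have hek := he k
    refine ⟨?_, ?_⟩
    · intro i
      induction i using Fin.lastCases with
      | last => simpa using hz
      | cast i =>
        have := h.1 i
        simp only [Fin.snoc_castSucc, Fin.val_castSucc]
        omega
    · intro i j hij
      induction i using Fin.lastCases with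
      | last => 
        have := j.2
        simp at hij
        omega
      | cast i =>
        induction j using Fin.lastCases with
        | last =>
          have := h.1 i
          simp only [Fin.snoc_castSucc, Fin.snoc_last, Fin.val_last]
          omega
        | cast j =>
          have := h.2 i j (by simpa using hij)
          simpa only [Fin.snoc_castSucc, Fin.val_castSucc] using this

theorem auxG_zero (a e : ℕ → ℕ) (m : ℕ) : auxG a e 0 m = 1 := by
  unfold auxG
  rw [Nat.card_eq_one_iff_unique]
  refine ⟨⟨fun x y => Subtype.ext (Subsingleton.elim _ _)⟩, ⟨⟨fun i => i.elim0, ?_⟩⟩⟩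
  exact ⟨fun i => i.elim0, fun i => i.elim0⟩

theorem auxG_succ {a e : ℕ → ℕ} (he : ∀ i, e i ≤ 1) (k m : ℕ) :
    auxG a e (k + 1) m = ∑ z ∈ Finset.Ico (a k) m, auxG a e k (z + e k) := by
  have := fun z => auxS_finite a e k (z + e k)
  rw [← Finset.sum_coe_sort]
  unfold auxG
  rw [← Nat.card_sigma]
  refine Nat.card_congr ?_
  refine Equiv.symm ⟨fun x => ⟨Fin.snoc x.2.1 x.1.1, ?_⟩,
    fun l => ⟨⟨l.1 (Fin.last k), ?_⟩, ⟨Fin.init l.1, ?_⟩⟩, ?_, ?_⟩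
  · exact (auxS_succ he _ _).2 ⟨Finset.mem_Ico.1 x.1.2, x.2.2⟩
  · have h := l.2
    rw [← Fin.snoc_init_self l.1, auxS_succ he] at h
    exact Finset.mem_Ico.2 h.1
  · have h := l.2
    rw [← Fin.snoc_init_self l.1, auxS_succ he] at h
    exact h.2
  · rintro ⟨⟨z, hz⟩, ⟨l, hl⟩⟩
    simp only [Sigma.mk.injEq, Subtype.mk.injEq, Fin.snoc_last, true_and]
    congr! 1
    · simp
    · simp
  · rintro ⟨l, hl⟩
    simp

open Polynomial in
theorem aux_main {R : Type*} [CommRing R] [Algebra ℚ R] {Y : Type*} (φ : Y → R →+* ℚ)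
    (a : ℕ → Y → ℕ) (pa : ℕ → R) (hpa : ∀ i x, φ x (pa i) = a i x)
    (htot : ∀ i j, (∀ x, a i x ≤ a j x) ∨ (∀ x, a j x ≤ a i x))
    (e : ℕ → ℕ) (he : ∀ i, e i ≤ 1) (k : ℕ) :
    ∃ (j : ℕ) (P : R[X]), ∀ x m,
      (m ≤ a j x → auxG (fun i => a i x) e (k + 1) m = 0) ∧
      (a j x ≤ m → (auxG (fun i => a i x) e (k + 1) m : ℚ) = eval₂ (φ x) (m : ℚ) P) := by
  induction k with
  | zero =>
    refine ⟨0, X - C (pa 0), fun x m => ⟨fun h => ?_, fun h => ?_⟩⟩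
    · rw [auxG_succ he, Finset.Ico_eq_empty (by simpa using h)]; simp
    · rw [auxG_succ he]
      simp only [auxG_zero]
      simp [eval₂_sub, hpa, Nat.cast_sub h]
  | succ k ih =>
    obtain ⟨j, P, hP⟩ := ih
    obtain ⟨Q, hQ⟩ := aux_sum_Ico P (e (k + 1))
    rcases htot j (k + 1) with hj | hj
    · refine ⟨k + 1, Q - C (Q.eval (pa (k + 1))), fun x m => ⟨fun h => ?_, fun h => ?_⟩⟩
      · rw [auxG_succ he, Finset.Ico_eq_empty (by simpa using h)]; simp
      · rw [auxG_succ he, eval₂_sub, eval₂_C, ← eval₂_at_apply, hpa, ← hQ _ _ _ h, Nat.cast_sum]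
        refine Finset.sum_congr rfl fun z hz => ?_
        have := (Finset.mem_Ico.1 hz).1
        exact (hP x _).2 (by have := hj x; omega)
    · refine ⟨j, Q - C (Q.eval (pa j)), fun x m => ⟨fun h => ?_, fun h => ?_⟩⟩
      · rw [auxG_succ he]
        refine Finset.sum_eq_zero fun z hz => (hP x _).1 ?_
        have := (Finset.mem_Ico.1 hz).2
        have := he (k + 1)
        omega
      · rw [auxG_succ he, eval₂_sub, eval₂_C, ← eval₂_at_apply, hpa, ← hQ _ _ _ h,
          ← Finset.sum_Ico_consecutive _ (hj x) h, Finset.sum_eq_zero, zero_add, Nat.cast_sum]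
        · refine Finset.sum_congr rfl fun z hz => ?_
          have := (Finset.mem_Ico.1 hz).1
          exact (hP x _).2 (by omega)
        · intro z hz
          refine (hP x _).1 ?_
          have := (Finset.mem_Ico.1 hz).2
          have := he (k + 1)
          omega

/-- Piecewise polynomiality of the chain-path counter function: for every choice of
strict comparison data — for each `k ∈ {2,…,s}` whether `ω_k < μ − 1` or `ω_k > μ − 1`
(recorded by `c`), and for each pair `2 ≤ j < k ≤ s` whether `ω_j < ω_k` or
`ω_j > ω_k` (recorded by `e`) — there is a polynomial `P ∈ ℚ[x, y₂,…,y_s]` such that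
`N(μ, ω₂,…,ω_s) = P(μ, ω₂,…,ω_s)` for all positive integers `μ, ω₂,…,ω_s` realizing
exactly those strict comparisons. -/
theorem chainPathCount_piecewise_polynomial (s t : ℕ)
    (hs : 2 ≤ s) (ht1 : 1 ≤ t) (ht2 : t ≤ s)
    (c : Fin (s - 1) → Bool) (e : Fin (s - 1) → Fin (s - 1) → Bool) :
    ∃ P : MvPolynomial (Unit ⊕ Fin (s - 1)) ℚ,
      ∀ (μ : ℕ) (ω : Fin (s - 1) → ℕ), 0 < μ → (∀ i, 0 < ω i) →
        (∀ i, (c i = true → (ω i : ℤ) < (μ : ℤ) - 1) ∧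
              (c i = false → (μ : ℤ) - 1 < (ω i : ℤ))) →
        (∀ i j : Fin (s - 1), i < j →
          (e i j = true → ω i < ω j) ∧ (e i j = false → ω j < ω i)) →
        (chainPathCount s t μ ω : ℚ) =
          MvPolynomial.eval (Sum.elim (fun _ => (μ : ℚ)) (fun i => (ω i : ℚ))) P := by
  obtain ⟨n, rfl⟩ : ∃ n, s = n + 2 := ⟨s - 2, by omega⟩
  change Fin (n + 1) → Bool at c
  change Fin (n + 1) → Fin (n + 1) → Bool at e
  let Y := {x : ℕ × (Fin (n + 1) → ℕ) // 0 < x.1 ∧ (∀ i, 0 < x.2 i) ∧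
        (∀ i, (c i = true → (x.2 i : ℤ) < (x.1 : ℤ) - 1) ∧
              (c i = false → (x.1 : ℤ) - 1 < (x.2 i : ℤ))) ∧
        (∀ i j : Fin (n + 1), i < j →
          (e i j = true → x.2 i < x.2 j) ∧ (e i j = false → x.2 j < x.2 i))}
  let φ : Y → MvPolynomial (Unit ⊕ Fin (n + 1)) ℚ →+* ℚ := fun x =>
    MvPolynomial.eval (Sum.elim (fun _ => (x.1.1 : ℚ)) (fun i => (x.1.2 i : ℚ)))
  let a : ℕ → Y → ℕ := fun i x => if h : i < n + 1 then max 1 (x.1.1 - x.1.2 ⟨i, h⟩) else 1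
  let pa : ℕ → MvPolynomial (Unit ⊕ Fin (n + 1)) ℚ := fun i =>
    if h : i < n + 1 then (if c ⟨i, h⟩ = true then
      MvPolynomial.X (Sum.inl ()) - MvPolynomial.X (Sum.inr ⟨i, h⟩) else 1) else 1
  have ha1 : ∀ i x, 1 ≤ a i x := by
    intro i x
    simp only [a]
    split_ifs <;> simp
  have hat : ∀ i (h : i < n + 1), c ⟨i, h⟩ = true → ∀ x : Y,
      a i x = x.1.1 - x.1.2 ⟨i, h⟩ ∧ x.1.2 ⟨i, h⟩ < x.1.1 := by
    intro i h hc x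
    have := (x.2.2.2.1 ⟨i, h⟩).1 hc
    simp only [a, dif_pos h]
    omega
  have haf : ∀ i, (∀ h : i < n + 1, c ⟨i, h⟩ = false) → ∀ x : Y, a i x = 1 := by
    intro i hc x
    by_cases h : i < n + 1
    · have := (x.2.2.2.1 ⟨i, h⟩).2 (hc h)
      simp only [a, dif_pos h]
      omega
    · simp only [a, dif_neg h]
  have hcase : ∀ i, (∃ h : i < n + 1, c ⟨i, h⟩ = true) ∨ (∀ h : i < n + 1, c ⟨i, h⟩ = false) := by
    intro i
    by_cases h : i < n + 1
    · cases hc : c ⟨i, h⟩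
      · exact Or.inr fun _ => hc
      · exact Or.inl ⟨h, hc⟩
    · exact Or.inr fun h' => absurd h' h
  have hpa : ∀ i x, φ x (pa i) = a i x := by
    intro i x
    rcases hcase i with ⟨h, hc⟩ | hc
    · obtain ⟨h1, h2⟩ := hat i h hc x
      rw [h1, Nat.cast_sub h2.le]
      simp only [pa, dif_pos h, if_pos hc]
      simp [φ]
    · rw [haf i hc x]
      by_cases h : i < n + 1
      · simp [pa, hc h]
      · simp only [pa, dif_neg h]
        simp
  have htot : ∀ i j, (∀ x, a i x ≤ a j x) ∨ (∀ x, a j x ≤ a i x) := by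
    intro i j
    rcases hcase i with ⟨hi, hci⟩ | hci
    · rcases hcase j with ⟨hj, hcj⟩ | hcj
      · have key : ∀ i j (hi : i < n + 1) (hj : j < n + 1), c ⟨i, hi⟩ = true →
            c ⟨j, hj⟩ = true → i < j → (∀ x, a i x ≤ a j x) ∨ (∀ x, a j x ≤ a i x) := by
          intro i j hi hj hci hcj hij
          cases he : e ⟨i, hi⟩ ⟨j, hj⟩
          · left
            intro x
            have := (x.2.2.2.2 ⟨i, hi⟩ ⟨j, hj⟩ hij).2 he
            rw [(hat i hi hci x).1, (hat j hj hcj x).1]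
            omega
          · right
            intro x
            have := (x.2.2.2.2 ⟨i, hi⟩ ⟨j, hj⟩ hij).1 he
            rw [(hat i hi hci x).1, (hat j hj hcj x).1]
            omega
        rcases lt_trichotomy i j with hij | hij | hij
        · exact key i j hi hj hci hcj hij
        · subst hij
          exact Or.inl fun x => le_rfl
        · exact (key j i hj hi hcj hci hij).symm
      · right
        intro x
        rw [haf j hcj x]
        exact ha1 i x
    · left
      intro x
      rw [haf i hci x]
      exact ha1 j x
  obtain ⟨j, P, hP⟩ := aux_main φ a pa hpa htot (fun i => if i + 2 ≤ t then 1 else 0)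
    (fun i => by split_ifs <;> simp) n
  refine ⟨P.eval (MvPolynomial.X (Sum.inl ()) + 1), fun μ ω hμ hω h1 h2 => ?_⟩
  let x : Y := ⟨(μ, ω), hμ, hω, h1, h2⟩
  have hx := (hP x (μ + 1)).2 (by
    simp only [a, x]
    split_ifs <;> omega)
  have h3 : ((μ + 1 : ℕ) : ℚ) = φ x (MvPolynomial.X (Sum.inl ()) + 1) := by
    simp [φ, x]
  rw [h3, Polynomial.eval₂_at_apply] at hx
  refine Eq.trans ?_ hx
  congr 1
  unfold chainPathCount auxG
  refine Nat.card_congr (Equiv.subtypeEquivRight fun l => ?_)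
  change Fin (n + 1) → ℕ at l
  unfold auxS
  have hai : ∀ i : Fin (n + 1), a i x = max 1 (μ - ω i) := by
    intro i
    simp only [a, x, dif_pos i.2]
  constructor
  · rintro ⟨g1, g2, g3, g4⟩
    refine ⟨fun i => ⟨?_, ?_⟩, fun i j hij => ?_⟩
    · simpa only [hai] using g3 i
    · have := g2 i
      omega
    · have := g4 i j hij
      dsimp only
      split_ifs <;> omega
  · rintro ⟨g1, g2⟩
    have g3 : ∀ i : Fin (n + 1), max 1 (μ - ω i) ≤ l i := fun i => by
      simpa only [hai] using (g1 i).1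
    refine ⟨fun i => ?_, fun i => ?_, g3, fun i j hij => ?_⟩
    · exact le_trans (le_max_left _ _) (g3 i)
    · have := (g1 i).2
      omega
    · have := g2 i j hij
      dsimp only at this
      split_ifs at this <;> omega
end
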